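/- Let F be an algebraically closed field of characteristic 0. A function f : G → F on isomorphism classes of finite multigraphs is the partition function of some k-color vertex model y : N^k → F if and only if f is multiplicative (f(∅)=1 and f(GH)=f(G)f(H)) and for each graph G = (V,E), each U ⊆ V with |U| = k+1, and each s : U → V, Σ_{π∈S_U} sgn(π) f(G_{s∘π}) = 0. -/

import Mathlib

structure MGraph : Type 1 where
  V : Type
  E : Type
  [fintV : Fintype V]
  [fintE : Fintype E]
  [decV : DecidableEq V]
  [decE : DecidableEq E]
  ends : E → V × V

attribute [instance] MGraph.fintV MGraph.fintE MGraph.decV MGraph.decE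

namespace MGraph

/-- multiplicity with which vertex `v` occurs among the endpoints of edge `e`
(a loop counts twice). -/
def inc (G : MGraph) (v : G.V) (e : G.E) : ℕ :=
  (if (G.ends e).1 = v then 1 else 0) + (if (G.ends e).2 = v then 1 else 0)

/-- `κ(δ(v))` : the incidence vector in `ℕ^k` of the multiset of colors seen at `v`. -/
def degVec (G : MGraph) {k : ℕ} (κ : G.E → Fin k) (v : G.V) : Fin k → ℕ :=
  fun c => ∑ e : G.E, if κ e = c then G.inc v e else 0

/-- the partition function of the `k`-color vertex model `y`. -/
def pf {F : Type} [CommRing F] (k : ℕ) (y : (Fin k → ℕ) → F) (G : MGraph) : F :=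
  ∑ κ : G.E → Fin k, ∏ v : G.V, y (G.degVec κ v)

def empty : MGraph where
  V := Empty
  E := Empty
  ends := Empty.elim

def disjUnion (G H : MGraph) : MGraph where
  V := G.V ⊕ H.V
  E := G.E ⊕ H.E
  ends := Sum.elim (fun e => (Sum.inl (G.ends e).1, Sum.inl (G.ends e).2))
    (fun e => (Sum.inr (H.ends e).1, Sum.inr (H.ends e).2))

/-- `G_t` : add the edges `{u t(u) | u ∈ U}`. -/
def addEdges (G : MGraph) (U : Finset G.V) (t : {v // v ∈ U} → G.V) : MGraph where
  V := G.V
  E := G.E ⊕ {v // v ∈ U}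
  ends := Sum.elim G.ends (fun u => (u.1, t u))

/-- `G/t` : add the edges `{u t(u) | u ∈ U}` and contract them. -/
noncomputable def contract (G : MGraph) (U : Finset G.V) (t : {v // v ∈ U} → G.V) : MGraph :=
  letI s : Setoid G.V := Relation.EqvGen.setoid (fun a b => ∃ h : a ∈ U, t ⟨a, h⟩ = b)
  letI : DecidableEq (Quotient s) := Classical.decEq _
  letI : Fintype (Quotient s) := Fintype.ofSurjective (Quotient.mk s)
    (fun q => Quot.exists_rep q)
  { V := Quotient s
    E := G.E
    ends := fun e => (Quotient.mk s (G.ends e).1, Quotient.mk s (G.ends e).2) }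

/-- isomorphism of multigraphs. -/
structure Iso (G H : MGraph) where
  vEquiv : G.V ≃ H.V
  eEquiv : G.E ≃ H.E
  ends_eq : ∀ e, H.ends (eEquiv e) = Prod.map vEquiv vEquiv (G.ends e) ∨
    H.ends (eEquiv e) = (Prod.map vEquiv vEquiv (G.ends e)).swap

end MGraph

set_option linter.unusedSectionVars false
set_option linter.unusedSimpArgs false
set_option linter.unusedVariables false
namespace PF
open Equiv Finset

section perm
variable {F : Type} [Field F] [CharZero F]
variable {H : Type} [Fintype H] [DecidableEq H]

def IsM (Y : Finset H) (M : Perm H) : Prop := M * M = 1 ∧ ∀ x, M x ≠ x ↔ x ∈ Y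

def PS (S : Finset H) : Finset (Perm H) := univ.filter (fun π => ∀ x, x ∉ S → π x = x)

lemma mem_PS {S : Finset H} {π : Perm H} : π ∈ PS S ↔ ∀ x, x ∉ S → π x = x := by simp [PS]

lemma one_mem_PS (S : Finset H) : (1 : Perm H) ∈ PS S := by simp [mem_PS]

lemma mul_mem_PS {S : Finset H} {π τ : Perm H} (h : π ∈ PS S) (h' : τ ∈ PS S) : π * τ ∈ PS S := by
  rw [mem_PS] at *
  intro x hx
  rw [Perm.mul_apply, h' x hx, h x hx]

lemma inv_mem_PS {S : Finset H} {π : Perm H} (h : π ∈ PS S) : π⁻¹ ∈ PS S := by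
  rw [mem_PS] at *
  intro x hx
  rw [Perm.inv_eq_iff_eq, h x hx]

lemma swap_mem_PS {S : Finset H} {x y : H} (hx : x ∈ S) (hy : y ∈ S) : swap x y ∈ PS S := by
  rw [mem_PS]
  intro z hz
  exact swap_apply_of_ne_of_ne (fun h => hz (h ▸ hx)) (fun h => hz (h ▸ hy))

lemma PS_mono {S S' : Finset H} (h : S ⊆ S') {π : Perm H} (hπ : π ∈ PS S) : π ∈ PS S' := by
  rw [mem_PS] at *
  exact fun x hx => hπ x (fun h' => hx (h h'))

lemma PS_apply_mem {S : Finset H} {π : Perm H} (hπ : π ∈ PS S) {x : H} (hx : x ∈ S) : π x ∈ S := by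
  by_contra h
  have := mem_PS.1 hπ _ h
  exact h (by rw [π.injective this]; exact hx)

lemma PS_comm {S S' : Finset H} (h : Disjoint S S') {π τ : Perm H} (hπ : π ∈ PS S) (hτ : τ ∈ PS S') :
    π * τ = τ * π := by
  have : Perm.Disjoint π τ := by
    intro x
    by_cases hx : x ∈ S
    · right; exact mem_PS.1 hτ x (fun h' => (Finset.disjoint_left.1 h hx h'))
    · left; exact mem_PS.1 hπ x hx
  exact this.commute

/-- conjugation action -/
def cj : Perm H →* Module.End F (Perm H → F) where
  toFun π := { toFun := fun f M => f (π⁻¹ * M * π)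
               map_add' := fun _ _ => rfl
               map_smul' := fun _ _ => rfl }
  map_one' := by ext f M; simp
  map_mul' π τ := by ext f M; simp [mul_assoc]

lemma cj_apply (π : Perm H) (f : Perm H → F) (M : Perm H) : cj π f M = f (π⁻¹ * M * π) := rfl

def sg (π : Perm H) : F := ((Perm.sign π : ℤ) : F)

lemma sg_mul (π τ : Perm H) : (sg (π * τ) : F) = sg π * sg τ := by simp [sg]
lemma sg_inv (π : Perm H) : (sg π⁻¹ : F) = sg π := by simp [sg]
lemma sg_sq (π : Perm H) : (sg π : F) * sg π = 1 := by
  rw [← sg_mul]; simp [sg]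
lemma sg_one : (sg (1 : Perm H) : F) = 1 := by simp [sg]
lemma sg_swap {x y : H} (h : x ≠ y) : (sg (swap x y) : F) = -1 := by simp [sg, Perm.sign_swap h]

def Alt (S : Finset H) : Module.End F (Perm H → F) := ∑ π ∈ PS S, (sg π : F) • cj π

lemma Alt_apply (S : Finset H) (f : Perm H → F) (M : Perm H) :
    Alt S f M = ∑ π ∈ PS S, sg π * f (π⁻¹ * M * π) := by
  simp [Alt, LinearMap.sum_apply, Finset.sum_apply, cj_apply]

lemma cj_mul_Alt {S : Finset H} {τ : Perm H} (h : τ ∈ PS S) :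
    (cj τ * Alt S : Module.End F (Perm H → F)) = (sg τ : F) • Alt S := by
  rw [Alt, Finset.mul_sum, Finset.smul_sum]
  refine Finset.sum_bij' (fun π _ => τ * π) (fun π _ => τ⁻¹ * π)
    (fun π hπ => mul_mem_PS h hπ) (fun π hπ => mul_mem_PS (inv_mem_PS h) hπ) (by simp) (by simp) ?_
  intro π hπ
  rw [sg_mul, smul_smul, ← mul_assoc, sg_sq, one_mul, map_mul, mul_smul_comm]

lemma neg1_smul (A : Module.End F (Perm H → F)) : (-1 : F) • A = -A := by
  ext f M; simp

lemma swap_mul_Alt {S : Finset H} {x y : H} (hx : x ∈ S) (hy : y ∈ S) (hxy : x ≠ y) :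
    cj (swap x y) * Alt S = -(Alt S : Module.End F (Perm H → F)) := by
  rw [cj_mul_Alt (swap_mem_PS hx hy), sg_swap hxy, neg1_smul]

lemma Alt_insert {S : Finset H} {x : H} (hx : x ∉ S) :
    (Alt (insert x S) : Module.End F (Perm H → F)) = (1 - ∑ s ∈ S, cj (swap s x)) * Alt S := by
  have h1 : (Alt (insert x S) : Module.End F (Perm H → F)) =
      ∑ s ∈ insert x S, ∑ π ∈ PS (insert x S) with π x = s, (sg π : F) • cj π := by
    rw [Alt]
    refine (Finset.sum_fiberwise_of_maps_to ?_ _).symm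
    intro π hπ
    exact PS_apply_mem hπ (mem_insert_self _ _)
  have h2 : ∀ s ∈ insert x S, ∑ π ∈ PS (insert x S) with π x = s, ((sg π : F) • cj π : Module.End F (Perm H → F)) =
      (sg (swap s x) : F) • (cj (swap s x) * Alt S) := by
    intro s hs
    rw [Alt, Finset.mul_sum, Finset.smul_sum]
    refine Finset.sum_bij' (fun π _ => swap s x * π) (fun π _ => swap s x * π) ?_ ?_ (by simp) (by simp) ?_
    · intro π hπ
      rw [Finset.mem_filter] at hπ
      rw [mem_PS]
      intro z hz
      by_cases hzx : z = x
      · subst hzx; simp [hπ.2]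
      · have h3 : z ∉ insert x S := by simp [hzx, hz]
        rw [Perm.mul_apply, mem_PS.1 hπ.1 z h3]
        exact swap_apply_of_ne_of_ne (fun h => h3 (h ▸ hs)) hzx
    · intro π hπ
      rw [Finset.mem_filter]
      refine ⟨mul_mem_PS (swap_mem_PS hs (mem_insert_self _ _)) (PS_mono (subset_insert _ _) hπ), ?_⟩
      rw [Perm.mul_apply, mem_PS.1 hπ x hx, swap_apply_right]
    · intro π hπ
      rw [sg_mul, mul_smul_comm, smul_smul, ← mul_assoc, sg_sq, one_mul, map_mul, ← mul_assoc, ← map_mul,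
        swap_mul_self, map_one, one_mul]
  rw [h1, Finset.sum_congr rfl h2, Finset.sum_insert hx, swap_self, sub_mul, Finset.sum_mul, one_mul]
  change (sg (1 : Perm H) : F) • (cj (1 : Perm H) * Alt S) + _ = _
  rw [sg_one, map_one, one_mul, one_smul, sub_eq_add_neg, ← Finset.sum_neg_distrib]
  congr 1
  refine Finset.sum_congr rfl fun s hs => ?_
  have hne : s ≠ x := fun h => hx (h ▸ hs)
  rw [sg_swap hne, neg1_smul]

lemma cj_conj_Alt (π : Perm H) (S : Finset H) :
    cj π * Alt S = Alt (S.map π.toEmbedding) * (cj π : Module.End F (Perm H → F)) := by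
  rw [Alt, Alt, Finset.mul_sum, Finset.sum_mul]
  refine Finset.sum_bij' (fun τ _ => π * τ * π⁻¹) (fun τ _ => π⁻¹ * τ * π) ?_ ?_ ?_ ?_ ?_
  · intro τ hτ
    rw [mem_PS] at *
    intro x hx
    have : π⁻¹ x ∉ S := fun h => hx (by rw [Finset.mem_map]; exact ⟨_, h, by simp⟩)
    show π (τ (π⁻¹ x)) = x
    rw [hτ _ this]; simp
  · intro τ hτ
    rw [mem_PS] at *
    intro x hx
    have : π x ∉ S.map π.toEmbedding := fun h => hx (by simpa using h)
    show π⁻¹ (τ (π x)) = x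
    rw [hτ _ this]; simp
  · intro τ _; group
  · intro τ _; group
  · intro τ _
    have : (sg (π * τ * π⁻¹) : F) = sg τ := by
      rw [sg_mul, sg_mul, sg_inv, mul_comm, ← mul_assoc, sg_sq, one_mul]
    rw [this, mul_smul_comm, smul_mul_assoc, ← map_mul, ← map_mul]
    congr 2
    group

lemma cj_comm_Alt {S S' : Finset H} (h : Disjoint S S') {π : Perm H} (hπ : π ∈ PS S) :
    cj π * Alt S' = Alt S' * (cj π : Module.End F (Perm H → F)) := by
  rw [Alt, Finset.mul_sum, Finset.sum_mul]
  refine Finset.sum_congr rfl fun τ hτ => ?_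
  rw [mul_smul_comm, smul_mul_assoc, ← map_mul, ← map_mul, PS_comm h hπ hτ]

lemma Alt_comm {S S' : Finset H} (h : Disjoint S S') :
    Alt S * Alt S' = Alt S' * (Alt S : Module.End F (Perm H → F)) := by
  conv_lhs => rw [Alt, Finset.sum_mul]
  conv_rhs => rw [Alt, Alt, Finset.mul_sum]
  refine Finset.sum_congr rfl fun τ hτ => ?_
  rw [← Alt, smul_mul_assoc, cj_comm_Alt h hτ, mul_smul_comm]

def TT (Y : Finset H) : Module.End F (Perm H → F) := ∑ i ∈ Y, ∑ j ∈ Y, cj (swap i j)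

lemma cj_comm_TT {Y : Finset H} {π : Perm H} (hπ : π ∈ PS Y) :
    cj π * TT Y = TT Y * (cj π : Module.End F (Perm H → F)) := by
  rw [TT, Finset.mul_sum, Finset.sum_mul]
  have hbij : ∀ g : H → Module.End F (Perm H → F), ∑ i ∈ Y, g (π i) = ∑ i ∈ Y, g i := by
    intro g
    refine Finset.sum_bij' (fun i _ => π i) (fun i _ => π⁻¹ i) (fun i hi => PS_apply_mem hπ hi)
      (fun i hi => PS_apply_mem (inv_mem_PS hπ) hi) (by simp) (by simp) (by simp)
  conv_rhs => rw [← hbij]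
  refine Finset.sum_congr rfl fun i _ => ?_
  rw [Finset.mul_sum, Finset.sum_mul]
  conv_rhs => rw [← hbij]
  refine Finset.sum_congr rfl fun j _ => ?_
  rw [← map_mul, ← map_mul]
  congr 1
  rw [Equiv.swap_apply_apply]; simp [mul_assoc]

lemma Alt_comm_TT {S Y : Finset H} (h : S ⊆ Y) :
    Alt S * TT Y = TT Y * (Alt S : Module.End F (Perm H → F)) := by
  rw [Alt, Finset.sum_mul, Finset.mul_sum]
  refine Finset.sum_congr rfl fun τ hτ => ?_
  rw [smul_mul_assoc, cj_comm_TT (PS_mono h hτ), mul_smul_comm]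

lemma IsM_conj {Y : Finset H} {M π : Perm H} (hπ : π ∈ PS Y) (h : IsM Y M) : IsM Y (π⁻¹ * M * π) := by
  refine ⟨?_, ?_⟩
  · have : π⁻¹ * M * π * (π⁻¹ * M * π) = π⁻¹ * (M * M) * π := by group
    rw [this, h.1]; group
  · intro x
    rw [Perm.mul_apply, Perm.mul_apply, Ne, Perm.inv_eq_iff_eq, eq_comm, eq_comm, ← Ne, h.2]
    constructor
    · intro h1
      have := PS_apply_mem (inv_mem_PS hπ) h1
      simpa using this
    · exact PS_apply_mem hπ

lemma IsM_conj_iff {Y : Finset H} {M π : Perm H} (hπ : π ∈ PS Y) : IsM Y (π⁻¹ * M * π) ↔ IsM Y M := by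
  refine ⟨fun h => ?_, IsM_conj hπ⟩
  have := IsM_conj (inv_mem_PS hπ) h
  have e : (π⁻¹)⁻¹ * (π⁻¹ * M * π) * π⁻¹ = M := by group
  rwa [e] at this

end perm
end PF

namespace PF
open Equiv Finset

section inj
variable {F : Type} [Field F] [CharZero F]
variable {H : Type} [Fintype H] [DecidableEq H]

def Killed (Y : Finset H) (q : ℕ) (f : Perm H → F) : Prop :=
  ∀ S ⊆ Y, S.card = q → Alt S f = 0

def Supp (Y : Finset H) (f : Perm H → F) : Prop := ∀ M, ¬ IsM Y M → f M = 0

lemma Killed.cj {Y : Finset H} {q : ℕ} {f : Perm H → F} (h : Killed Y q f) {π : Perm H} (hπ : π ∈ PS Y) :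
    Killed Y q (cj π f) := by
  intro S hS hc
  have e := cj_conj_Alt (F := F) π (S.map (π⁻¹).toEmbedding)
  have e2 : (S.map (π⁻¹).toEmbedding).map π.toEmbedding = S := by
    rw [Finset.map_map]
    convert Finset.map_refl
    ext x; simp
  rw [e2] at e
  have := congrArg (fun A => A f) e
  simp only [Module.End.mul_apply] at this
  rw [← this, h _ ?_ (by simpa using hc), map_zero]
  intro x hx
  rw [Finset.mem_map] at hx
  obtain ⟨y, hy, rfl⟩ := hx
  exact PS_apply_mem (inv_mem_PS hπ) (hS hy)

lemma Killed.Alt {Y : Finset H} {q : ℕ} {f : Perm H → F} (h : Killed Y q f) {T : Finset H} (hT : T ⊆ Y) :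
    Killed Y q (Alt T f) := by
  intro S hS hc
  rw [show PF.Alt T f = ∑ π ∈ PS T, ((sg π : F) • PF.cj π) f by rw [PF.Alt, LinearMap.sum_apply], map_sum]
  refine Finset.sum_eq_zero fun π hπ => ?_
  rw [LinearMap.smul_apply, map_smul, h.cj (PS_mono hT hπ) S hS hc, smul_zero]

lemma Supp.cj {Y : Finset H} {f : Perm H → F} (h : Supp Y f) {π : Perm H} (hπ : π ∈ PS Y) :
    Supp Y (cj π f) := by
  intro M hM
  rw [cj_apply]
  exact h _ (fun h' => hM ((IsM_conj_iff hπ).1 h'))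

lemma Supp.Alt {Y : Finset H} {f : Perm H → F} (h : Supp Y f) {T : Finset H} (hT : T ⊆ Y) :
    Supp Y (Alt T f) := by
  intro M hM
  rw [Alt_apply]
  refine Finset.sum_eq_zero fun π hπ => ?_
  rw [h _ (fun h' => hM ((IsM_conj_iff (PS_mono hT hπ)).1 h')), mul_zero]

lemma cj_Alt_apply {S : Finset H} {τ : Perm H} (h : τ ∈ PS S) (f : Perm H → F) :
    cj τ (Alt S f) = (sg τ : F) • Alt S f := by
  rw [← Module.End.mul_apply, cj_mul_Alt h]; rfl

lemma swap_Alt_apply {S : Finset H} {x y : H} (hx : x ∈ S) (hy : y ∈ S) (hxy : x ≠ y) (f : Perm H → F) :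
    cj (swap x y) (Alt S f) = - Alt S f := by
  rw [← Module.End.mul_apply, swap_mul_Alt hx hy hxy]; rfl

lemma sum_swap_Alt {Y S : Finset H} {q : ℕ} {f : Perm H → F} (h : Killed Y (q+1) f) (hS : S ⊆ Y)
    (hc : S.card = q) {x : H} (hx : x ∈ Y) (hxS : x ∉ S) :
    ∑ s ∈ S, cj (swap s x) (Alt S f) = Alt S f := by
  have := h (insert x S) (by intro z hz; rw [mem_insert] at hz; rcases hz with rfl | hz; exacts [hx, hS hz])
    (by rw [card_insert_of_notMem hxS, hc])
  rw [Alt_insert hxS, Module.End.mul_apply, LinearMap.sub_apply, LinearMap.sum_apply,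
    Module.End.one_apply, sub_eq_zero] at this
  exact this.symm

lemma TT_split {Z S : Finset H} {q : ℕ} (hS : S ⊆ Z) (hc : S.card = q) (h : Perm H → F)
    (h1 : ∀ s ∈ S, ∀ s' ∈ S, s ≠ s' → cj (swap s s') h = - h)
    (h2 : ∀ x ∈ Z, x ∉ S → ∑ s ∈ S, cj (swap s x) h = h) :
    TT Z h = TT (Z \ S) h + (2 * (Z.card : F) - (q : F)^2) • h := by
  have hz : ∀ (g : H → Perm H → F), ∑ i ∈ Z, g i = ∑ i ∈ S, g i + ∑ i ∈ Z \ S, g i := by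
    intro g
    rw [add_comm, Finset.sum_sdiff hS]
  have hq : ∀ X : Finset H, TT X h = ∑ i ∈ X, ∑ j ∈ X, cj (swap i j) h := by
    intro X; simp [TT, LinearMap.sum_apply]
  have hA : ∑ i ∈ S, ∑ j ∈ S, cj (swap i j) h = (2 * (q:F) - (q : F)^2) • h := by
    have : ∀ i ∈ S, ∑ j ∈ S, cj (swap i j) h = (2 - (q : F)) • h := by
      intro i hi
      rw [← Finset.add_sum_erase S _ hi, swap_self]
      have e1 : cj (Equiv.refl H) h = h := by ext M; rfl
      rw [e1, Finset.sum_congr rfl (g := fun _ => -h)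
        (fun j hj => h1 i hi j (mem_of_mem_erase hj) (ne_of_mem_erase hj).symm),
        Finset.sum_const, card_erase_of_mem hi, hc]
      have : 1 ≤ q := by rw [← hc]; exact Finset.card_pos.2 ⟨i, hi⟩
      rw [← Nat.cast_smul_eq_nsmul F, Nat.cast_sub this, smul_neg]
      module
    rw [Finset.sum_congr rfl this, Finset.sum_const, hc, ← Nat.cast_smul_eq_nsmul F, smul_smul]
    congr 1; ring
  have hB : ∑ i ∈ Z \ S, ∑ j ∈ S, cj (swap i j) h = ((Z.card : F) - q) • h := by
    rw [Finset.sum_congr rfl (g := fun _ => h), Finset.sum_const, card_sdiff_of_subset hS, hc,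
      ← Nat.cast_smul_eq_nsmul F, Nat.cast_sub (by rw [← hc]; exact card_le_card hS)]
    intro i hi
    rw [mem_sdiff] at hi
    simp_rw [swap_comm i]
    exact h2 i hi.1 hi.2
  have hB' : ∑ i ∈ S, ∑ j ∈ Z \ S, cj (swap i j) h = ((Z.card : F) - q) • h := by
    rw [Finset.sum_comm, ← hB]
    simp_rw [swap_comm]
  rw [hq, hq, hz]
  simp_rw [hz]
  rw [Finset.sum_add_distrib, Finset.sum_add_distrib, hA, hB, hB']
  module

lemma injA (k : ℕ) : ∀ n : ℕ, ∀ Y : Finset H, Y.card = n → ∀ r ≤ k, ∀ (f : Perm H → F) (c : ℤ),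
    Supp Y f → Killed Y (r+1) f → (n : ℤ) * (k - 2) ≤ c → (n = 0 → 0 < c) →
    TT Y f + (c : F) • f = 0 → f = 0 := by
  intro n
  induction n using Nat.strong_induction_on with
  | _ n IH =>
  intro Y hY r
  by_cases hn : n = 0
  · intro _ f c _ _ _ hc ht
    have : Y = ∅ := by rw [← card_eq_zero, hY, hn]
    subst this
    rw [TT, Finset.sum_empty, LinearMap.zero_apply, zero_add] at ht
    have hc' : (c : F) ≠ 0 := by
      have := hc hn
      exact_mod_cast this.ne'
    exact (smul_eq_zero.1 ht).resolve_left hc'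
  induction r with
  | zero =>
    intro _ f c _ hk _ _ _
    obtain ⟨x, hx⟩ : Y.Nonempty := by rw [← card_pos]; omega
    have := hk {x} (by simpa using hx) (by simp)
    rw [← this]
    have hP : PS ({x} : Finset H) = {1} := by
      ext π
      rw [mem_PS, mem_singleton]
      constructor
      · intro h
        ext z
        by_cases hz : z = x
        · subst hz
          by_contra h'
          have h2 := h (π z) (by simpa using h')
          exact h' (π.injective h2)
        · exact h z (by simpa using hz)
      · rintro rfl; simp
    ext M
    rw [Alt_apply, hP]
    simp [sg_one]
  | succ r ihr =>
    intro hr f c hs hk hc hc0 ht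
    refine ihr (by omega) f c hs ?_ hc hc0 ht
    intro S hS hSc
    set q := r + 1 with hq
    have hk1 := hk.Alt hS
    have hs1 := hs.Alt hS
    set h1 := Alt S f with hh1
    have ht1 : TT Y h1 + (c : F) • h1 = 0 := by
      have := congrArg (Alt S) ht
      rw [map_add, map_smul, map_zero, ← Module.End.mul_apply, Alt_comm_TT hS] at this
      exact this
    ext M
    by_cases hM : IsM Y M
    swap
    · exact hs1 M hM
    have hMM : ∀ x, M (M x) = x := fun x => by
      have := congrArg (fun A => A x) hM.1
      exact this
    have hMi : M⁻¹ = M := inv_eq_of_mul_eq_one_left hM.1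
    have hMY : ∀ x, x ∈ Y → M x ∈ Y := by
      intro x hx
      rw [← hM.2, hMM]
      exact fun h => ((hM.2 x).2 hx) h.symm
    by_cases hin : ∃ s ∈ S, M s ∈ S
    · obtain ⟨s, hsS, hMs⟩ := hin
      have hne : s ≠ M s := fun h => ((hM.2 s).2 (hS hsS)) h.symm
      have e1 := congrFun (swap_Alt_apply hsS hMs hne f) M
      rw [cj_apply] at e1
      have e2 : (swap s (M s))⁻¹ * M * swap s (M s) = M := by
        have : swap (M s) (M (M s)) = M * swap s (M s) * M⁻¹ := Equiv.swap_apply_apply M s (M s)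
        rw [hMM, swap_comm] at this
        rw [swap_inv]
        nth_rewrite 1 [this]
        rw [hMi]
        calc M * swap s (M s) * M * M * swap s (M s) = M * swap s (M s) * (M * M) * swap s (M s) := by group
          _ = M := by rw [hM.1, mul_one, mul_assoc, swap_mul_self, mul_one]
      rw [e2, Pi.neg_apply, eq_neg_iff_add_eq_zero, ← two_mul] at e1
      exact (mul_eq_zero.1 e1).resolve_left two_ne_zero
    push Not at hin
    set S' := S.map M.toEmbedding with hS'
    have hdis : Disjoint S S' := by
      rw [Finset.disjoint_left]
      intro x hx hx'
      rw [hS', Finset.mem_map] at hx'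
      obtain ⟨y, hy, rfl⟩ := hx'
      exact hin y hy hx
    have hS'Y : S' ⊆ Y := by
      intro x hx
      rw [hS', Finset.mem_map] at hx
      obtain ⟨y, hy, rfl⟩ := hx
      exact hMY y (hS hy)
    have hS'c : S'.card = q := by rw [hS', card_map, hSc]
    set h := Alt S' h1 with hh
    have hh' : h = Alt S (Alt S' f) := by
      rw [hh, hh1, ← Module.End.mul_apply, ← Module.End.mul_apply, Alt_comm hdis]
    have hkh := hk1.Alt hS'Y
    have hsh := hs1.Alt hS'Y
    rw [← hh] at hkh hsh
    have hth : TT Y h + (c : F) • h = 0 := by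
      have := congrArg (Alt S') ht1
      rw [map_add, map_smul, map_zero, ← Module.End.mul_apply, Alt_comm_TT hS'Y] at this
      exact this
    have split1 := TT_split (q := q) hS hSc h
      (by rw [hh']; exact fun s hs s' hs' hne => swap_Alt_apply hs hs' hne _)
      (by rw [hh']; exact fun x hx hxS => sum_swap_Alt (hk.Alt hS'Y) hS hSc hx hxS)
    have split2 := TT_split (q := q) (Z := Y \ S) (S := S')
      (by intro x hx; rw [mem_sdiff]; exact ⟨hS'Y hx, fun h' => Finset.disjoint_left.1 hdis h' hx⟩) hS'c h
      (by rw [hh]; exact fun s hs s' hs' hne => swap_Alt_apply hs hs' hne _)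
      (by rw [hh]; exact fun x hx hxS => sum_swap_Alt hk1 hS'Y hS'c (mem_sdiff.1 hx).1 hxS)
    set Y' := (Y \ S) \ S' with hY'
    have cY1 : ((Y \ S).card : F) = n - q := by
      rw [card_sdiff_of_subset hS, hY, hSc, Nat.cast_sub]
      rw [← hY, ← hSc]; exact card_le_card hS
    have hqn : 2 * q ≤ n := by
      have : (S ∪ S').card ≤ Y.card := card_le_card (union_subset hS hS'Y)
      rw [card_union_of_disjoint hdis, hSc, hS'c, hY] at this
      omega
    have cY' : Y'.card = n - 2 * q := by
      have : Y' = Y \ (S ∪ S') := by rw [hY', sdiff_sdiff_left]; rfl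
      rw [this, card_sdiff_of_subset (union_subset hS hS'Y), card_union_of_disjoint hdis, hSc, hS'c, hY]
      omega
    have hthY' : TT Y' h + ((c + 4 * n - 2 * q - 2 * q^2 : ℤ) : F) • h = 0 := by
      rw [split1, split2, cY1, hY] at hth
      rw [← hth]
      push_cast
      module
    -- restrict
    set T := S ∪ S' with hT
    have hMT : ∀ x, x ∈ T ↔ M x ∈ T := by
      have key : ∀ x, x ∈ T → M x ∈ T := by
        intro x hx
        rw [hT, mem_union] at hx ⊢
        rcases hx with hx | hx
        · right; rw [hS', Finset.mem_map]; exact ⟨x, hx, rfl⟩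
        · left
          rw [hS', Finset.mem_map] at hx
          obtain ⟨y, hy, rfl⟩ := hx
          show M (M y) ∈ S
          rw [hMM]; exact hy
      intro x
      exact ⟨key x, fun h => by have := key _ h; rwa [hMM] at this⟩
    let σ : Perm H := Perm.ofSubtype (M.subtypePerm (p := fun x => x ∈ T) (fun x => (hMT x).symm))
    have hσT : ∀ x, x ∈ T → σ x = M x := by
      intro x hx
      exact (Perm.ofSubtype_apply_of_mem _ hx)
    have hσn : ∀ x, x ∉ T → σ x = x := by
      intro x hx
      exact (Perm.ofSubtype_apply_of_not_mem _ hx)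
    have hYT : ∀ x, x ∈ Y' ↔ x ∈ Y ∧ x ∉ T := by
      intro x; simp [hY', hT, mem_sdiff, and_assoc]
    have hTY : T ⊆ Y := union_subset hS hS'Y
    have hσσ : σ * σ = 1 := by
      ext x
      rw [Perm.mul_apply, Perm.one_apply]
      by_cases hx : x ∈ T
      · rw [hσT x hx, hσT _ ((hMT x).1 hx), hMM]
      · rw [hσn x hx, hσn x hx]
    have hdYT : Disjoint Y' T := by
      rw [Finset.disjoint_left]; intro x hx; exact ((hYT x).1 hx).2
    have hσPS : σ ∈ PS T := mem_PS.2 hσn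
    have hgood : ∀ N, IsM Y' N → IsM Y (σ * N) := by
      intro N hN
      have hNP : N ∈ PS Y' := by
        rw [mem_PS]; intro x hx; by_contra h'; exact hx ((hN.2 x).1 h')
      have hcm : N * σ = σ * N := PS_comm hdYT hNP hσPS
      refine ⟨?_, ?_⟩
      · calc σ * N * (σ * N) = σ * (N * σ) * N := by group
          _ = (σ * σ) * (N * N) := by rw [hcm]; group
          _ = 1 := by rw [hσσ, hN.1, one_mul]
      · intro x
        by_cases hx : x ∈ T
        · have : x ∉ Y' := fun h => ((hYT x).1 h).2 hx
          rw [Perm.mul_apply, mem_PS.1 hNP x this, hσT x hx]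
          exact hM.2 x
        · by_cases hx' : x ∈ Y'
          · have h3 := PS_apply_mem hNP hx'
            rw [Perm.mul_apply, hσn _ ((hYT _).1 h3).2, hN.2]
            exact ⟨fun _ => ((hYT _).1 hx').1, fun _ => hx'⟩
          · rw [Perm.mul_apply, mem_PS.1 hNP x hx', hσn x hx]
            simp only [ne_eq, not_true_eq_false, false_iff]
            exact fun h => hx' ((hYT x).2 ⟨h, hx⟩)
    classical
    let g : Perm H → F := fun N => if IsM Y' N then h (σ * N) else 0
    have hgs : Supp Y' g := by intro N hN; simp [g, hN]
    have hgc : ∀ π ∈ PS Y', ∀ N, IsM Y' N → cj π g N = cj π h (σ * N) := by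
      intro π hπ N hN
      rw [cj_apply, cj_apply]
      simp only [g]
      rw [if_pos (IsM_conj hπ hN)]
      congr 1
      have := PS_comm hdYT (inv_mem_PS hπ) hσPS
      calc σ * (π⁻¹ * N * π) = (σ * π⁻¹) * N * π := by group
        _ = _ := by rw [← this]; group
    have hg0 : g = 0 := by
      refine IH (n - 2 * q) (by omega) Y' cY' q hr g (c + 4 * n - 2 * q - 2 * q^2) hgs ?_ ?_ ?_ ?_
      · intro U hU hUc
        ext N
        by_cases hN : IsM Y' N
        · have hUY : U ⊆ Y := fun x hx => ((hYT x).1 (hU hx)).1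
          have h0 := congrFun (hkh U hUY hUc) (σ * N)
          rw [Alt_apply] at h0 ⊢
          refine Eq.trans ?_ h0
          refine Finset.sum_congr rfl fun π hπ => ?_
          have := hgc π (PS_mono hU hπ) N hN
          rw [cj_apply, cj_apply] at this
          rw [this]
        · exact (hgs.Alt hU) N hN
      · rw [Nat.cast_sub hqn]
        have h5 : (q : ℤ) ≤ k := by exact_mod_cast hr
        have h6 : (1 : ℤ) ≤ q := by exact_mod_cast (by omega : 1 ≤ q)
        have h7 : 2 * (q : ℤ) ≤ n := by exact_mod_cast hqn
        push_cast
        nlinarith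
      · intro h8
        have h5 : (q : ℤ) ≤ k := by exact_mod_cast hr
        have h6 : (1 : ℤ) ≤ q := by exact_mod_cast (by omega : 1 ≤ q)
        have h7 : 2 * (q : ℤ) ≤ n := by exact_mod_cast hqn
        have h9 : (n : ℤ) = 2 * q := by omega
        rw [h9] at hc ⊢
        nlinarith
      · ext N
        by_cases hN : IsM Y' N
        · have h0 := congrFun hthY' (σ * N)
          simp only [Pi.add_apply, Pi.smul_apply, Pi.zero_apply, TT, LinearMap.sum_apply,
            Finset.sum_apply] at h0 ⊢
          rw [← h0]
          congr 1
          · refine Finset.sum_congr rfl fun i hi => Finset.sum_congr rfl fun j hj => ?_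
            exact hgc _ (swap_mem_PS hi hj) N hN
          · simp only [g, if_pos hN]
        · simp only [Pi.add_apply, Pi.smul_apply, Pi.zero_apply, TT, LinearMap.sum_apply,
            Finset.sum_apply]
          rw [hgs N hN, smul_zero, add_zero]
          refine Finset.sum_eq_zero fun i hi => Finset.sum_eq_zero fun j hj => ?_
          exact (hgs.cj (swap_mem_PS hi hj)) N hN
    have hhM : h M = 0 := by
      have hN0 : IsM Y' (σ * M) := by
        have hval : ∀ x, (σ * M) x = if x ∈ T then x else M x := by
          intro x
          rw [Perm.mul_apply]
          split_ifs with hx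
          · rw [hσT _ ((hMT x).1 hx), hMM]
          · exact hσn _ (fun h => hx ((hMT x).2 h))
        refine ⟨?_, ?_⟩
        · ext x
          rw [Perm.mul_apply, hval x]
          split_ifs with hx
          · rw [hval, if_pos hx]; rfl
          · rw [hval, if_neg (fun h => hx ((hMT x).2 h)), hMM]; rfl
        · intro x
          rw [hval, hYT]
          split_ifs with hx
          · simp [hx]
          · rw [hM.2]; simp [hx]
      have := congrFun hg0 (σ * M)
      simp only [g, if_pos hN0] at this
      rwa [← mul_assoc, hσσ, one_mul] at this
    have hcard : h M = ((PS S').card : F) * h1 M := by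
      rw [hh, Alt_apply, ← nsmul_eq_mul, ← Finset.sum_const]
      refine Finset.sum_congr rfl fun π hπ => ?_
      have hπ' : M * π * M ∈ PS S := by
        rw [mem_PS]
        intro x hx
        have : M x ∉ S' := by
          intro h; rw [hS', Finset.mem_map] at h
          obtain ⟨y, hy, hyx⟩ := h
          exact hx (by rw [← M.injective hyx]; exact hy)
        rw [Perm.mul_apply, Perm.mul_apply, mem_PS.1 hπ _ this, hMM]
      have hcm : (M * π * M) * π⁻¹ = π⁻¹ * (M * π * M) := PS_comm hdis hπ' (inv_mem_PS hπ)
      have e1 := congrFun (cj_Alt_apply (inv_mem_PS hπ') f) M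
      rw [cj_apply, inv_inv] at e1
      have e2 : M * π * M * M * (M * π * M)⁻¹ = π⁻¹ * M * π := by
        have : (M * π * M)⁻¹ = M * π⁻¹ * M := by rw [mul_inv_rev, mul_inv_rev, hMi, mul_assoc]
        rw [this]
        calc M * π * M * M * (M * π⁻¹ * M) = M * π * M * (M * M) * π⁻¹ * M := by group
          _ = (M * π * M) * π⁻¹ * M := by rw [hM.1, mul_one]
          _ = π⁻¹ * M * π * (M * M) := by rw [hcm]; group
          _ = π⁻¹ * M * π := by rw [hM.1, mul_one]
      rw [e2] at e1
      rw [hh1, e1, Pi.smul_apply, smul_eq_mul, sg_inv, sg_mul, sg_mul]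
      have := sg_sq (F := F) π
      have h2 := sg_sq (F := F) M
      linear_combination (Alt S f M) * (sg M * sg M) * this + (Alt S f M) * h2
    rw [hhM] at hcard
    have hne : ((PS S').card : F) ≠ 0 := by
      rw [Nat.cast_ne_zero, ← Nat.pos_iff_ne_zero, card_pos]
      exact ⟨1, one_mem_PS _⟩
    exact (mul_eq_zero.1 hcard.symm).resolve_left hne

end inj
end PF

namespace PF
open Equiv Finset

section sft
variable {F : Type} [Field F] [CharZero F] {k : ℕ}
variable {H : Type} [Fintype H] [DecidableEq H]

def Mt (M : Perm H) : Prop := M * M = 1 ∧ ∀ x, M x ≠ x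

lemma Mt_iff {M : Perm H} : Mt M ↔ IsM univ M := by simp [Mt, IsM]

lemma Mt.app {M : Perm H} (h : Mt M) (x : H) : M (M x) = x := by
  have := congrArg (fun A => A x) h.1
  exact this

lemma Mt.conj {M : Perm H} (h : Mt M) (π : Perm H) : Mt (π⁻¹ * M * π) := by
  rw [Mt_iff] at *
  exact IsM_conj (by simp [mem_PS]) h

def Comp (φ : H → Fin k) (M : Perm H) : Prop := ∀ h, φ (M h) = φ h

instance (φ : H → Fin k) (M : Perm H) : Decidable (Comp φ M) := by unfold Comp; infer_instance

def ind (F : Type) [Field F] (M : Perm H) (φ : H → Fin k) : F := if Comp φ M then 1 else 0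

def Inv (F : Type) [Field F] (H : Type) [Fintype H] [DecidableEq H] (k : ℕ) : Submodule F ((H → Fin k) → F) :=
  Submodule.span F {t | ∃ M : Perm H, Mt M ∧ t = ind F M}

def pair (t : (H → Fin k) → F) (M : Perm H) : F := ∑ φ, t φ * ind F M φ

/-- alternating on matchings -/
def AltF (k : ℕ) (f : Perm H → F) : Prop :=
  ∀ S : Finset H, S.card = k + 1 → ∀ M, Mt M → ∑ π ∈ PS S, sg π * f (π⁻¹ * M * π) = 0

abbrev Sub (a b : H) := {h : H // h ≠ a ∧ h ≠ b}

def ext (a b : H) (φ : Sub a b → Fin k) (c : Fin k) : H → Fin k :=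
  fun h => if hh : h ≠ a ∧ h ≠ b then φ ⟨h, hh⟩ else c

lemma ext_a (a b : H) (φ : Sub a b → Fin k) (c : Fin k) : ext a b φ c a = c := by simp [ext]
lemma ext_b (a b : H) (φ : Sub a b → Fin k) (c : Fin k) : ext a b φ c b = c := by simp [ext]
lemma ext_sub (a b : H) (φ : Sub a b → Fin k) (c : Fin k) (x : Sub a b) : ext a b φ c x = φ x := by
  simp [ext, x.2]

lemma sum_ext {a b : H} (G : (H → Fin k) → F) :
    ∑ φ : H → Fin k, (if φ a = φ b then G φ else 0) = ∑ φ : Sub a b → Fin k, ∑ c, G (ext a b φ c) := by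
  rw [← Finset.sum_filter, ← Fintype.sum_prod_type']
  refine Finset.sum_bij' (fun φ _ => (fun x => φ x, φ a)) (fun p _ => ext a b p.1 p.2) (by simp)
    (by intro p _; simp [ext_a, ext_b]) ?_ ?_ ?_
  · intro φ hφ
    funext x
    by_cases hx : x ≠ a ∧ x ≠ b
    · simp [ext, hx]
    · simp only [ext, dif_neg hx]
      rw [mem_filter] at hφ
      by_cases hxa : x = a
      · rw [hxa]
      · have : x = b := by by_contra h; exact hx ⟨hxa, h⟩
        rw [this]; exact hφ.2
  · intro p _
    ext x
    · simp [ext_sub]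
    · simp [ext_a]
  · intro φ hφ
    congr 1
    funext x
    by_cases hx : x ≠ a ∧ x ≠ b
    · simp [ext, hx]
    · simp only [ext, dif_neg hx]
      rw [mem_filter] at hφ
      by_cases hxa : x = a
      · rw [hxa]
      · have : x = b := by by_contra h; exact hx ⟨hxa, h⟩
        rw [this]; exact hφ.2.symm

/-- gluing an edge -/
def glue (a b : H) (M : Perm (Sub a b)) : Perm H := Perm.ofSubtype M * swap a b

lemma glue_a {a b : H} (M : Perm (Sub a b)) : glue a b M a = b := by
  rw [glue, Perm.mul_apply, swap_apply_left]
  exact Perm.ofSubtype_apply_of_not_mem _ (by simp)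
lemma glue_b {a b : H} (M : Perm (Sub a b)) : glue a b M b = a := by
  rw [glue, Perm.mul_apply, swap_apply_right]
  exact Perm.ofSubtype_apply_of_not_mem _ (by simp)
lemma glue_sub {a b : H} (M : Perm (Sub a b)) (x : Sub a b) : glue a b M x = M x := by
  rw [glue, Perm.mul_apply, swap_apply_of_ne_of_ne x.2.1 x.2.2]
  exact Perm.ofSubtype_apply_coe _ _

lemma sub_cases {a b : H} {p : H → Prop} (ha : p a) (hb : p b) (hs : ∀ x : Sub a b, p x) (x : H) : p x := by
  by_cases h1 : x = a
  · rw [h1]; exact ha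
  by_cases h2 : x = b
  · rw [h2]; exact hb
  exact hs ⟨x, h1, h2⟩

lemma Mt_glue {a b : H} (hab : a ≠ b) {M : Perm (Sub a b)} (h : Mt M) : Mt (glue a b M) := by
  refine ⟨?_, ?_⟩
  · refine Equiv.ext fun x => ?_
    refine sub_cases (a := a) (b := b) (p := fun x => (glue a b M * glue a b M) x = (1 : Perm H) x) ?_ ?_ ?_ x
    · show glue a b M (glue a b M a) = a
      rw [glue_a, glue_b]
    · show glue a b M (glue a b M b) = b
      rw [glue_b, glue_a]
    · intro x
      show glue a b M (glue a b M x) = x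
      rw [glue_sub, glue_sub, h.app]
  · refine sub_cases (a := a) (b := b) ?_ ?_ ?_
    · rw [glue_a]; exact hab.symm
    · rw [glue_b]; exact hab
    · intro x
      rw [glue_sub]
      exact fun h' => h.2 x (Subtype.ext h')

lemma exists_glue {a b : H} {N : Perm H} (hN : Mt N) (h : N a = b) :
    ∃ M : Perm (Sub a b), Mt M ∧ glue a b M = N := by
  have hb : N b = a := by rw [← h, hN.app]
  have hs : ∀ x, (N x ≠ a ∧ N x ≠ b) ↔ (x ≠ a ∧ x ≠ b) := by
    intro x
    have e1 : N x = a ↔ x = b := by rw [← hb]; exact N.injective.eq_iff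
    have e2 : N x = b ↔ x = a := by
      constructor
      · intro hx; exact N.injective (by rw [hx, h])
      · intro hx; rw [hx, h]
    rw [Ne, Ne, e1, e2]; tauto
  refine ⟨N.subtypePerm hs, ⟨?_, ?_⟩, ?_⟩
  · ext x
    show (N (N x) : H) = x
    exact hN.app _
  · intro x hx
    exact hN.2 x (congrArg Subtype.val hx)
  · refine Equiv.ext fun x => ?_
    refine sub_cases (a := a) (b := b) (p := fun x => glue a b (N.subtypePerm hs) x = N x) ?_ ?_ ?_ x
    · rw [glue_a, h]
    · rw [glue_b, hb]
    · intro x; rw [glue_sub]; rfl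

lemma Comp_glue {a b : H} (M : Perm (Sub a b)) (φ : H → Fin k) :
    Comp φ (glue a b M) ↔ φ a = φ b ∧ Comp (fun x : Sub a b => φ x) M := by
  constructor
  · intro h
    refine ⟨?_, ?_⟩
    · have := h a; rw [glue_a] at this; exact this.symm
    · intro x; have := h x; rw [glue_sub] at this; exact this
  · rintro ⟨h1, h2⟩
    refine sub_cases (a := a) (b := b) ?_ ?_ ?_
    · rw [glue_a, h1]
    · rw [glue_b, h1]
    · intro x; rw [glue_sub]; exact h2 x

/-- contraction lemma -/
lemma contr {a b : H} (hab : a ≠ b) {M : Perm H} (hM : Mt M) :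
    ∃ M' : Perm (Sub a b), Mt M' ∧ glue a b M' = (swap (M a) b)⁻¹ * M * swap (M a) b ∧
      ∀ φ : Sub a b → Fin k, ∑ c, ind F M (ext a b φ c) = (if M a = b then (k : F) else 1) * ind F M' φ := by
  have hN := hM.conj (swap (M a) b)
  have hNa : ((swap (M a) b)⁻¹ * M * swap (M a) b) a = b := by
    rw [Perm.mul_apply, Perm.mul_apply, swap_inv]
    rw [swap_apply_of_ne_of_ne (hM.2 a).symm hab, swap_apply_left]
  obtain ⟨M', hM', hg⟩ := exists_glue hN hNa
  refine ⟨M', hM', hg, ?_⟩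
  intro φ
  by_cases h : M a = b
  · rw [if_pos h]
    have : glue a b M' = M := by rw [hg, h, swap_self]; rfl
    rw [Finset.sum_congr rfl (g := fun _ => ind F M' φ)]
    · simp
    · intro c _
      rw [ind, ind, ← this]
      congr 1
      rw [Comp_glue]
      simp [ext_a, ext_b, ext_sub]
  · rw [if_neg h, one_mul]
    have hMb : M b ≠ a := fun h' => h (by rw [← h', hM.app])
    set u : Sub a b := ⟨M a, hM.2 a, h⟩ with hu
    set v : Sub a b := ⟨M b, hMb, hM.2 b⟩ with hv
    have hval : ∀ x : Sub a b, (M' x : H) = swap (M a) b (M (swap (M a) b x)) := by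
      intro x
      rw [← glue_sub, hg, swap_inv]; rfl
    have hMu : M' u = v := by
      apply Subtype.ext
      rw [hval, hu, hv]
      show swap (M a) b (M (swap (M a) b (M a))) = M b
      rw [swap_apply_left]
      exact swap_apply_of_ne_of_ne (fun h' => hab (M.injective h').symm) (hM.2 b)
    have hMv : M' v = u := by rw [← hMu, hM'.app]
    have hMx : ∀ x : Sub a b, x ≠ u → x ≠ v → (M' x : H) = M x := by
      intro x hxu hxv
      have h1 : (x : H) ≠ M a := fun h' => hxu (Subtype.ext h')
      have h2 : (x : H) ≠ M b := fun h' => hxv (Subtype.ext h')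
      rw [hval, swap_apply_of_ne_of_ne h1 x.2.2]
      refine swap_apply_of_ne_of_ne (fun h' => x.2.1 (M.injective h')) (fun h' => h2 ?_)
      exact (hM.app x).symm.trans (congrArg M h')
    have key : ∀ c, Comp (ext a b φ c) M ↔ c = φ u ∧ Comp φ M' := by
      intro c
      constructor
      · intro hc
        have h1 : φ u = c := by
          have := hc a
          rw [ext_a] at this; rw [← this]; exact (ext_sub a b φ c u).symm
        have h2 : φ v = c := by
          have := hc b
          rw [ext_b] at this; rw [← this]; exact (ext_sub a b φ c v).symm
        refine ⟨h1.symm, ?_⟩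
        intro x
        by_cases hxu : x = u
        · rw [hxu, hMu, h1, h2]
        by_cases hxv : x = v
        · rw [hxv, hMv, h1, h2]
        have := hc x
        rw [← hMx x hxu hxv, ext_sub, ext_sub] at this
        exact this
      · rintro ⟨h1, h2⟩
        have h3 : φ v = c := by rw [h1, ← hMu, h2]
        refine sub_cases (a := a) (b := b) ?_ ?_ ?_
        · rw [ext_a, h1]; exact (ext_sub a b φ _ u)
        · rw [ext_b, ← h3]; exact (ext_sub a b φ _ v)
        · intro x
          rw [ext_sub]
          by_cases hxu : x = u
          · rw [hxu, hu]; show ext a b φ c (M (M a)) = _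
            rw [hM.app, ext_a, h1]
          by_cases hxv : x = v
          · rw [hxv, h3, hv]; show ext a b φ c (M (M b)) = _
            rw [hM.app, ext_b]
          rw [← hMx x hxu hxv, ext_sub, h2]
    simp only [ind, key, ite_and]
    rw [Finset.sum_ite_eq' univ (φ u)]
    simp

lemma pair_add (t s : (H → Fin k) → F) (M : Perm H) : pair (t + s) M = pair t M + pair s M := by
  simp [pair, add_mul, Finset.sum_add_distrib]

lemma pair_sum {ι : Type} (A : Finset ι) (t : ι → (H → Fin k) → F) (M : Perm H) :
    pair (∑ i ∈ A, t i) M = ∑ i ∈ A, pair (t i) M := by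
  simp only [pair, Finset.sum_apply, Finset.sum_mul]
  rw [Finset.sum_comm]

lemma ind_mem {M : Perm H} (h : Mt M) : (ind F M : (H → Fin k) → F) ∈ Inv F H k :=
  Submodule.subset_span ⟨M, h, rfl⟩

/-- extending an invariant by an edge -/
def extT (a b : H) (t : (Sub a b → Fin k) → F) : (H → Fin k) → F :=
  fun φ => if φ a = φ b then t (fun x => φ x) else 0

lemma extT_mem {a b : H} (hab : a ≠ b) {t : (Sub a b → Fin k) → F} (ht : t ∈ Inv F (Sub a b) k) :
    extT a b t ∈ Inv F H k := by
  refine Submodule.span_induction ?_ ?_ ?_ ?_ ht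
  · rintro _ ⟨M, hM, rfl⟩
    have : extT a b (ind F M : (Sub a b → Fin k) → F) = ind F (glue a b M) := by
      funext φ
      simp only [extT, ind, Comp_glue, ite_and]
    rw [this]
    exact ind_mem (Mt_glue hab hM)
  · have : extT a b (0 : (Sub a b → Fin k) → F) = 0 := by funext φ; simp [extT]
    rw [this]; exact zero_mem _
  · intro x y _ _ hx hy
    have : extT a b (x + y) = extT a b x + extT a b y := by
      funext φ; simp only [extT, Pi.add_apply]; split_ifs <;> simp
    rw [this]; exact add_mem hx hy
  · intro c x _ hx
    have : extT a b (c • x) = c • extT a b x := by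
      funext φ; simp only [extT, Pi.smul_apply]; split_ifs <;> simp
    rw [this]; exact Submodule.smul_mem _ _ hx

lemma pair_extT {a b : H} (t : (Sub a b → Fin k) → F) {M : Perm H} {M' : Perm (Sub a b)} {r : F}
    (h : ∀ φ : Sub a b → Fin k, ∑ c, ind F M (ext a b φ c) = r * ind F M' φ) :
    pair (extT a b t) M = r * pair t M' := by
  have : pair (extT a b t) M = ∑ φ : H → Fin k, if φ a = φ b then t (fun x => φ x) * ind F M φ else 0 := by
    refine Finset.sum_congr rfl fun φ _ => ?_
    simp only [extT]; split_ifs <;> simp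
  rw [this, sum_ext (a := a) (b := b) (fun φ : H → Fin k => t (fun x => φ x) * ind F M φ), pair, Finset.mul_sum]
  refine Finset.sum_congr rfl fun φ _ => ?_
  simp only [ext_sub]
  rw [← Finset.mul_sum, h]
  ring

lemma AltF_glue {a b : H} {g : Perm H → F} (hab : a ≠ b) (hg : Killed univ (k+1) g) :
    AltF k (fun M : Perm (Sub a b) => g (glue a b M)) := by
  intro S hS M hM
  have h0 := congrFun (hg (S.map (Function.Embedding.subtype _)) (subset_univ _) (by rw [card_map, hS]))
    (glue a b M)
  rw [Alt_apply] at h0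
  refine Eq.trans ?_ h0
  have hmem : ∀ x : H, x ∈ S.map (Function.Embedding.subtype (fun h => h ≠ a ∧ h ≠ b)) ↔
      ∃ hx : x ≠ a ∧ x ≠ b, (⟨x, hx⟩ : Sub a b) ∈ S := by
    intro x; simp
  refine Finset.sum_bij (fun π _ => Perm.ofSubtype π) ?_ ?_ ?_ ?_
  · intro π hπ
    rw [mem_PS] at hπ ⊢
    intro x hx
    rw [hmem] at hx
    by_cases hx' : x ≠ a ∧ x ≠ b
    · have h1 := hπ ⟨x, hx'⟩ (fun h => hx ⟨hx', h⟩)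
      exact (Perm.ofSubtype_apply_coe π ⟨x, hx'⟩).trans (congrArg Subtype.val h1)
    · exact Perm.ofSubtype_apply_of_not_mem _ hx'
  · intro π _ π' _ h
    exact Perm.ofSubtype_injective h
  · intro τ hτ
    have hτ' := mem_PS.1 hτ
    have hs : ∀ x, (τ x ≠ a ∧ τ x ≠ b) ↔ (x ≠ a ∧ x ≠ b) := by
      intro x
      by_cases hx : x ∈ S.map (Function.Embedding.subtype (fun h => h ≠ a ∧ h ≠ b))
      · have h1 := PS_apply_mem hτ hx
        rw [hmem] at hx h1
        obtain ⟨h1, _⟩ := h1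
        obtain ⟨h2, _⟩ := hx
        exact ⟨fun _ => h2, fun _ => h1⟩
      · rw [hτ' x hx]
    refine ⟨τ.subtypePerm hs, ?_, ?_⟩
    · rw [mem_PS]
      intro x hx
      apply Subtype.ext
      show τ x = x
      apply hτ'
      rw [hmem]
      rintro ⟨_, h⟩
      exact hx h
    · refine Perm.ofSubtype_subtypePerm hs ?_
      intro x hx
      by_contra h'
      apply hx
      apply hτ'
      rw [hmem]
      rintro ⟨h, _⟩
      exact h' h
  · intro π hπ
    have e1 : (sg (Perm.ofSubtype π) : F) = sg π := by rw [sg, Perm.sign_ofSubtype]; rfl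
    rw [e1]
    congr 1
    refine congrArg g ?_
    show Perm.ofSubtype (π⁻¹ * M * π) * swap a b = (Perm.ofSubtype π)⁻¹ * (Perm.ofSubtype M * swap a b) * Perm.ofSubtype π
    rw [map_mul, map_mul, map_inv]
    have hc : swap a b * Perm.ofSubtype π = Perm.ofSubtype π * swap a b := by
      refine PS_comm (S := {a, b}) (S' := univ.filter (fun x => x ≠ a ∧ x ≠ b)) ?_ ?_ ?_
      · rw [Finset.disjoint_left]; intro x hx; simp at hx ⊢; rcases hx with h | h <;> simp [h]
      · exact swap_mem_PS (by simp) (by simp)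
      · rw [mem_PS]; intro x hx
        exact Perm.ofSubtype_apply_of_not_mem _ (by simpa using hx)
    calc (Perm.ofSubtype π)⁻¹ * Perm.ofSubtype M * Perm.ofSubtype π * swap a b
        = (Perm.ofSubtype π)⁻¹ * Perm.ofSubtype M * (Perm.ofSubtype π * swap a b) := by group
      _ = _ := by rw [← hc]; group

theorem sft (k : ℕ) : ∀ n : ℕ, ∀ (H : Type) [Fintype H] [DecidableEq H], Fintype.card H = n →
    ∀ f : Perm H → F, AltF k f → ∃ t ∈ Inv F H k, ∀ M, Mt M → f M = pair t M := by
  intro n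
  induction n using Nat.strong_induction_on with
  | _ n IH =>
  intro H _ _ hn f hf
  by_cases h0 : n = 0
  · have : IsEmpty H := Fintype.card_eq_zero_iff.1 (by omega)
    have hMt : ∀ M : Perm H, Mt M := fun M => ⟨Subsingleton.elim _ _, fun x => isEmptyElim x⟩
    refine ⟨f 1 • ind F 1, Submodule.smul_mem _ _ (ind_mem (hMt 1)), ?_⟩
    intro M _
    have hM : M = 1 := Subsingleton.elim _ _
    subst hM
    simp [pair, ind, Comp]
  classical
  let Z : Submodule F (Perm H → F) :=
    { carrier := {f | Supp univ f ∧ Killed univ (k+1) f}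
      add_mem' := by
        rintro a b ⟨h1, h2⟩ ⟨h3, h4⟩
        exact ⟨fun M hM => by rw [Pi.add_apply, h1 M hM, h3 M hM, add_zero],
          fun S hS hc => by rw [map_add, h2 S hS hc, h4 S hS hc, add_zero]⟩
      zero_mem' := ⟨fun M hM => rfl, fun S hS hc => map_zero _⟩
      smul_mem' := by
        rintro c x ⟨h1, h2⟩
        exact ⟨fun M hM => by rw [Pi.smul_apply, h1 M hM, smul_zero],
          fun S hS hc => by rw [map_smul, h2 S hS hc, smul_zero]⟩ }
  let A : Module.End F (Perm H → F) := TT univ + (((n : ℤ) * (k - 2) : ℤ) : F) • 1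
  have hA : ∀ x ∈ Z, A x ∈ Z := by
    intro x hx
    refine add_mem ?_ (Submodule.smul_mem _ _ hx)
    rw [TT, LinearMap.sum_apply]
    refine sum_mem fun i _ => ?_
    rw [LinearMap.sum_apply]
    refine sum_mem fun j _ => ?_
    exact ⟨hx.1.cj (by simp [mem_PS]), hx.2.cj (by simp [mem_PS])⟩
  have hinj : Function.Injective (A.restrict hA) := by
    rw [← LinearMap.ker_eq_bot, LinearMap.ker_eq_bot']
    rintro ⟨x, hx⟩ h
    have h' : A x = 0 := congrArg Subtype.val h
    apply Subtype.ext
    exact injA k n univ (by rw [card_univ, hn]) k le_rfl x _ hx.1 hx.2 le_rfl (fun h => absurd h h0) h'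
  have hsurj := LinearMap.injective_iff_surjective.1 hinj
  let f0 : Perm H → F := fun M => if IsM univ M then f M else 0
  have hf0s : Supp univ f0 := fun M hM => by simp [f0, hM]
  have hf0 : f0 ∈ Z := by
    refine ⟨hf0s, ?_⟩
    intro S hS hc
    ext M
    by_cases hM : IsM univ M
    · rw [Alt_apply]
      refine Eq.trans ?_ (hf S hc M (Mt_iff.2 hM))
      refine Finset.sum_congr rfl fun π hπ => ?_
      simp only [f0]
      rw [if_pos (IsM_conj (by simp [mem_PS]) hM)]
    · exact hf0s.Alt hS M hM
  obtain ⟨⟨g, hg⟩, hgf⟩ := hsurj ⟨f0, hf0⟩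
  have hgf' : A g = f0 := congrArg Subtype.val hgf
  have hIH : ∀ p : H × H, ∃ t ∈ Inv F H k, p.1 ≠ p.2 → ∀ M, Mt M →
      pair t M = (if M p.1 = p.2 then (k : F) else 1) * cj (swap (M p.1) p.2) g M := by
    rintro ⟨a, b⟩
    by_cases hab : a = b
    · exact ⟨0, zero_mem _, fun h => absurd hab h⟩
    obtain ⟨t, ht, htp⟩ := IH (Fintype.card (Sub a b)) (by
      rw [← hn]; exact Fintype.card_subtype_lt (x := a) (by simp)) (Sub a b) rfl _ (AltF_glue hab hg.2)
    refine ⟨extT a b t, extT_mem hab ht, fun _ M hM => ?_⟩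
    obtain ⟨M', hM', hgl, hc⟩ := contr (F := F) (k := k) hab hM
    rw [pair_extT t hc, ← htp M' hM', hgl]; rfl
  choose t ht htp using hIH
  refine ⟨∑ i : H, ∑ j ∈ univ.filter (fun j => j ≠ i), t (i, j),
    sum_mem fun i _ => sum_mem fun j _ => ht _, ?_⟩
  intro M hM
  have e0 : f M = f0 M := by simp only [f0]; rw [if_pos (Mt_iff.1 hM)]
  rw [e0, ← hgf', pair_sum]
  have e1 : ∀ i : H, pair (∑ j ∈ univ.filter (fun j => j ≠ i), t (i, j)) M =
      ∑ j, cj (swap (M i) j) g M + ((k : F) - 2) * g M := by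
    intro i
    rw [pair_sum, Finset.sum_congr rfl (g := fun j => (if M i = j then ((k : F) - 1) * g M else 0) +
      cj (swap (M i) j) g M)]
    · rw [Finset.sum_add_distrib]
      have e3 : ∑ j, cj (swap (M i) j) g M = g M + ∑ j ∈ univ.filter (fun j => j ≠ i), cj (swap (M i) j) g M := by
        have e4 : cj (swap (M i) i) g M = g M := by
          rw [cj_apply]
          congr 1
          have : swap (M (M i)) (M i) = M * swap (M i) i * M⁻¹ := Equiv.swap_apply_apply M (M i) i
          rw [hM.app, swap_comm] at this
          rw [swap_inv]
          nth_rewrite 1 [this]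
          have hMi : M⁻¹ = M := inv_eq_of_mul_eq_one_left hM.1
          calc M * swap (M i) i * M⁻¹ * M * swap (M i) i = M * (swap (M i) i * swap (M i) i) := by group
            _ = M := by rw [swap_mul_self, mul_one]
        rw [Finset.filter_ne']
        nth_rewrite 1 [← e4]
        exact (Finset.add_sum_erase univ (fun j => cj (swap (M i) j) g M) (mem_univ i)).symm
      rw [e3, Finset.sum_ite_eq, if_pos (by simp [hM.2 i])]
      ring
    · intro j hj
      rw [mem_filter] at hj
      rw [htp _ hj.2.symm M hM]
      simp only
      split_ifs with h
      · rw [← h, swap_self]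
        have : cj (Equiv.refl H) g M = g M := rfl
        rw [this]; ring
      · ring
  simp_rw [e1]
  rw [Finset.sum_add_distrib, Equiv.sum_comp M (fun i => ∑ j, cj (swap i j) g M)]
  simp only [A, LinearMap.add_apply, LinearMap.smul_apply, Pi.add_apply, Pi.smul_apply, Module.End.one_apply, TT,
    LinearMap.sum_apply, Finset.sum_apply]
  congr 1
  rw [Finset.sum_const, card_univ, hn]
  push_cast
  rw [nsmul_eq_mul, smul_eq_mul]; ring

end sft
end PF

namespace PF
open Equiv Finset

section sol
variable {F : Type} [Field F] [CharZero F] {k : ℕ}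
variable {H : Type} [Fintype H] [DecidableEq H]
variable {H' : Type} [Fintype H'] [DecidableEq H']

def IsSol (f : Perm H → F) (t : (H → Fin k) → F) : Prop :=
  t ∈ Inv F H k ∧ ∀ M, Mt M → pair t M = f M

lemma exists_sol {f : Perm H → F} (hf : AltF k f) : ∃ t : (H → Fin k) → F, IsSol f t := by
  obtain ⟨t, h1, h2⟩ := sft k _ H rfl f hf
  exact ⟨t, h1, fun M hM => (h2 M hM).symm⟩

lemma Comp_conj (ψ : H → Fin k) (M π : Perm H) : Comp ψ (π⁻¹ * M * π) ↔ Comp (ψ ∘ (π⁻¹ : Perm H)) M := by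
  constructor
  · intro h x
    have := h (π⁻¹ x)
    simpa using this
  · intro h x
    have := h (π x)
    simpa using this

lemma AltF_ind (ψ : H → Fin k) : AltF k (fun M => ind F M ψ) := by
  intro S hS M hM
  obtain ⟨x, hx, y, hy, hxy, he⟩ := Finset.exists_ne_map_eq_of_card_lt_of_maps_to (s := S) (t := univ)
    (f := ψ) (by simp [hS]) (by simp)
  refine Finset.sum_involution (fun π _ => π * swap x y) ?_ ?_ ?_ ?_
  · intro π hπ
    rw [sg_mul, sg_swap hxy]
    have : (ind F ((π * swap x y)⁻¹ * M * (π * swap x y)) ψ : F) = ind F (π⁻¹ * M * π) ψ := by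
      simp only [ind]
      congr 1
      rw [Comp_conj, Comp_conj]
      have : ψ ∘ ((π * swap x y)⁻¹ : Perm H) = ψ ∘ (π⁻¹ : Perm H) := by
        funext z
        rw [mul_inv_rev, swap_inv]
        simp only [Function.comp_apply, Perm.mul_apply]
        by_cases h1 : π⁻¹ z = x
        · rw [h1, swap_apply_left, he]
        by_cases h2 : π⁻¹ z = y
        · rw [h2, swap_apply_right, he]
        rw [swap_apply_of_ne_of_ne h1 h2]
      rw [this]
    simp only
    rw [this]; ring
  · intro π hπ _ h
    have : swap x y = 1 := mul_left_cancel (h.trans (mul_one π).symm)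
    exact hxy (swap_eq_one_iff.1 this)
  · intro π hπ; exact mul_mem_PS hπ (swap_mem_PS hx hy)
  · intro π hπ; rw [mul_assoc, swap_mul_self, mul_one]

noncomputable def EE (F : Type) [Field F] [CharZero F] (φ ψ : H → Fin k) : F :=
  (exists_sol (AltF_ind (F := F) ψ)).choose φ

lemma EE_sol (ψ : H → Fin k) : IsSol (fun M => ind F M ψ) (fun φ => EE F φ ψ) :=
  (exists_sol (AltF_ind (F := F) ψ)).choose_spec

lemma EE_mem (ψ : H → Fin k) : (fun φ => EE F φ ψ) ∈ Inv F H k := (EE_sol ψ).1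

lemma EE_repr {d : (H → Fin k) → F} (hd : d ∈ Inv F H k) (ψ : H → Fin k) : ∑ φ, d φ * EE F φ ψ = d ψ := by
  refine Submodule.span_induction ?_ ?_ ?_ ?_ hd
  · rintro _ ⟨M, hM, rfl⟩
    refine Eq.trans ?_ ((EE_sol (F := F) ψ).2 M hM)
    exact Finset.sum_congr rfl fun φ _ => mul_comm _ _
  · simp
  · intro x y _ _ hx hy
    rw [Pi.add_apply, ← hx, ← hy, ← Finset.sum_add_distrib]
    exact Finset.sum_congr rfl fun φ _ => by rw [Pi.add_apply, add_mul]
  · intro c x _ hx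
    rw [Pi.smul_apply, ← hx, Finset.smul_sum]
    exact Finset.sum_congr rfl fun φ _ => by rw [Pi.smul_apply, smul_mul_assoc]

lemma EE_symm (φ ψ : H → Fin k) : EE F φ ψ = EE F ψ φ := by
  rw [← EE_repr (EE_mem (F := F) ψ) φ, ← EE_repr (EE_mem (F := F) φ) ψ]
  exact Finset.sum_congr rfl fun χ _ => mul_comm _ _

lemma EE_mem' (φ : H → Fin k) : (fun ψ => EE F φ ψ) ∈ Inv F H k := by
  have := EE_mem (F := F) φ
  simpa only [EE_symm φ] using this

lemma pairing_zero {d s : (H → Fin k) → F} (h : ∀ M, Mt M → pair d M = 0) (hs : s ∈ Inv F H k) :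
    ∑ φ, d φ * s φ = 0 := by
  refine Submodule.span_induction ?_ ?_ ?_ ?_ hs
  · rintro _ ⟨M, hM, rfl⟩; exact h M hM
  · simp
  · intro x y _ _ hx hy
    simp only [Pi.add_apply, mul_add, Finset.sum_add_distrib, hx, hy, add_zero]
  · intro c x _ hx
    simp only [Pi.smul_apply, smul_eq_mul, mul_left_comm _ c, ← Finset.mul_sum, hx, mul_zero]

lemma Inv_ext {d d' : (H → Fin k) → F} (hd : d ∈ Inv F H k) (hd' : d' ∈ Inv F H k)
    (h : ∀ M, Mt M → pair d M = pair d' M) : d = d' := by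
  rw [← sub_eq_zero]
  have hm : d - d' ∈ Inv F H k := sub_mem hd hd'
  funext ψ
  rw [← EE_repr hm ψ]
  refine pairing_zero ?_ (EE_mem ψ)
  intro M hM
  have := h M hM
  simp only [pair] at this
  simp only [pair, Pi.sub_apply, sub_mul, Finset.sum_sub_distrib, this, sub_self]

lemma sol_unique {f : Perm H → F} {t t' : (H → Fin k) → F} (h : IsSol f t) (h' : IsSol f t') : t = t' :=
  Inv_ext h.1 h'.1 (fun M hM => by rw [h.2 M hM, h'.2 M hM])

lemma Mt_congr (e : H ≃ H') {M : Perm H} (h : Mt M) : Mt (e.permCongr M) := by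
  refine ⟨?_, ?_⟩
  · ext x; simp [h.app]
  · intro x hx
    rw [Equiv.permCongr_apply] at hx
    exact h.2 (e.symm x) (by rw [Equiv.eq_symm_apply]; exact hx)

lemma ind_congr (e : H ≃ H') (M : Perm H) (φ : H' → Fin k) :
    (ind F (e.permCongr M) φ : F) = ind F M (φ ∘ e) := by
  simp only [ind]
  congr 1
  apply propext
  constructor
  · intro h x
    have := h (e x)
    simpa using this
  · intro h x
    have := h (e.symm x)
    simpa using this

lemma Inv_congr (e : H ≃ H') {t : (H → Fin k) → F} (ht : t ∈ Inv F H k) :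
    (fun φ : H' → Fin k => t (φ ∘ e)) ∈ Inv F H' k := by
  refine Submodule.span_induction ?_ ?_ ?_ ?_ ht
  · rintro _ ⟨M, hM, rfl⟩
    convert ind_mem (F := F) (k := k) (Mt_congr e hM) using 1
    funext φ
    rw [ind_congr]
  · exact zero_mem _
  · intro x y _ _ hx hy; exact add_mem hx hy
  · intro c x _ hx; exact Submodule.smul_mem _ c hx

lemma sol_congr (e : H ≃ H') {f : Perm H → F} {f' : Perm H' → F}
    (hff : ∀ M, Mt M → f M = f' (e.permCongr M)) {t : (H → Fin k) → F} {t' : (H' → Fin k) → F}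
    (h : IsSol f t) (h' : IsSol f' t') (φ : H' → Fin k) : t' φ = t (φ ∘ e) := by
  have : t' = fun φ : H' → Fin k => t (φ ∘ e) := by
    refine Inv_ext h'.1 (Inv_congr e h.1) ?_
    intro M hM
    obtain ⟨N, rfl⟩ := (e.permCongr).surjective M
    have hN : Mt N := by
      have := Mt_congr e.symm hM
      rwa [← Equiv.permCongr_symm, Equiv.symm_apply_apply] at this
    rw [h'.2 _ hM, ← hff N hN, ← h.2 N hN]
    simp only [pair, ind_congr]
    exact (Equiv.sum_comp (e.arrowCongr (Equiv.refl (Fin k))).symm (fun φ => t φ * ind F N φ)).symm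
  rw [this]

lemma EE_congr (e : H ≃ H') (φ ψ : H' → Fin k) : EE F φ ψ = EE F (φ ∘ e) (ψ ∘ e) := by
  refine sol_congr e ?_ (EE_sol (F := F) (ψ ∘ e)) (EE_sol (F := F) ψ) φ
  intro M _
  rw [ind_congr]

lemma EE_contr {a b : H} (hab : a ≠ b) (φ : Sub a b → Fin k) (ψ : H → Fin k) :
    ∑ c, EE F (ext a b φ c) ψ = if ψ a = ψ b then EE F φ (fun x => ψ x) else 0 := by
  have key : (fun φ : Sub a b → Fin k => ∑ c, EE F (ext a b φ c) ψ) =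
      fun φ => if ψ a = ψ b then EE F φ (fun x : Sub a b => ψ x) else 0 := by
    refine Inv_ext ?_ ?_ ?_
    · have := EE_mem (F := F) ψ
      refine Submodule.span_induction (x := fun φ => EE F φ ψ) (p := fun t _ => (fun φ : Sub a b → Fin k => ∑ c, t (ext a b φ c)) ∈
        Inv F (Sub a b) k) ?_ ?_ ?_ ?_ this
      · rintro _ ⟨M, hM, rfl⟩
        obtain ⟨M', hM', _, hc⟩ := contr (F := F) (k := k) hab hM
        simp only [hc]
        exact Submodule.smul_mem _ _ (ind_mem hM')
      · simp only [Pi.zero_apply, Finset.sum_const_zero]; exact zero_mem _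
      · intro x y _ _ hx hy
        simp only [Pi.add_apply, Finset.sum_add_distrib]; exact add_mem hx hy
      · intro c x _ hx
        simp only [Pi.smul_apply, ← Finset.smul_sum]; exact Submodule.smul_mem _ c hx
    · by_cases h : ψ a = ψ b
      · simp only [if_pos h]; exact EE_mem _
      · simp only [if_neg h]; exact zero_mem _
    · intro M hM
      have e1 : pair (fun φ : Sub a b → Fin k => ∑ c, EE F (ext a b φ c) ψ) M =
          pair (fun φ => EE F φ ψ) (glue a b M) := by
        have : pair (fun φ => EE F φ ψ) (glue a b M) =
            ∑ φ : H → Fin k, if φ a = φ b then EE F φ ψ * ind F M (fun x : Sub a b => φ x) else 0 := by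
          refine Finset.sum_congr rfl fun φ _ => ?_
          simp only [ind, Comp_glue, ite_and]
          split_ifs <;> simp
        rw [this, sum_ext (a := a) (b := b) (fun φ : H → Fin k => EE F φ ψ * ind F M (fun x : Sub a b => φ x))]
        refine Finset.sum_congr rfl fun φ _ => ?_
        rw [Finset.sum_mul]
        simp only [ext_sub]
      rw [e1, (EE_sol ψ).2 _ (Mt_glue hab hM)]
      by_cases h : ψ a = ψ b
      · simp only [if_pos h]
        rw [(EE_sol (F := F) (fun x : Sub a b => ψ x)).2 M hM]
        simp [ind, Comp_glue, h]
      · simp [pair, h, ind, Comp_glue]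
  exact congrFun key φ

lemma EE_empty [IsEmpty H] (φ ψ : H → Fin k) : EE F φ ψ = 1 := by
  have hM : Mt (1 : Perm H) := ⟨Subsingleton.elim _ _, fun x => isEmptyElim x⟩
  have := EE_repr (ind_mem (F := F) (k := k) hM) ψ
  simpa [ind, Comp, Subsingleton.elim φ ψ, Subsingleton.elim default ψ] using this

end sol

section lin
variable {F : Type} [Field F] {τ : Type}

lemma exists_equiv_of_map {H H' : Type} [Fintype H] [Fintype H'] (a : H → τ) (b : H' → τ)
    (h : (univ : Finset H).val.map a = (univ : Finset H').val.map b) : ∃ e : H ≃ H', a = b ∘ e := by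
  classical
  have hc : ∀ c, Nonempty ({x // a x = c} ≃ {y // b y = c}) := by
    intro c
    have h1 := congrArg (Multiset.count c) h
    rw [Multiset.count_map, Multiset.count_map] at h1
    refine ⟨Fintype.equivOfCardEq ?_⟩
    rw [Fintype.card_subtype, Fintype.card_subtype]
    simp only [eq_comm (a := c)] at h1
    exact h1
  let e := fun c => (hc c).some
  exact ⟨Equiv.ofFiberEquiv e, funext fun x => (Equiv.ofFiberEquiv_map e x).symm⟩

lemma prod_X_eq {H : Type} [Fintype H] [DecidableEq τ] (a : H → τ) :
    (∏ h, MvPolynomial.X (a h) : MvPolynomial τ F) =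
      MvPolynomial.monomial (Multiset.toFinsupp ((univ : Finset H).val.map a)) 1 := by
  have : (Multiset.toFinsupp ((univ : Finset H).val.map a)) = ∑ h, Finsupp.single (a h) 1 := by
    have h1 : (univ : Finset H).val.map a = ∑ h, ({a h} : Multiset τ) := by
      rw [Finset.sum, ← Multiset.sum_map_singleton ((univ : Finset H).val.map a), Multiset.map_map]; rfl
    rw [h1, map_sum]
    exact Finset.sum_congr rfl fun h _ => Multiset.toFinsupp_singleton _
  rw [this, MvPolynomial.monomial_sum_one]
  rfl

lemma exists_lin (val : ∀ (H : Type) [Fintype H] [DecidableEq H], (H → τ) → F)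
    (hval : ∀ (H H' : Type) [Fintype H] [DecidableEq H] [Fintype H'] [DecidableEq H'] (e : H ≃ H') (a : H' → τ),
      val H (a ∘ e) = val H' a) :
    ∃ L : MvPolynomial τ F →ₗ[F] F, ∀ (H : Type) [Fintype H] [DecidableEq H] (a : H → τ),
      L (∏ h, MvPolynomial.X (a h)) = val H a := by
  classical
  let v : (τ →₀ ℕ) → F := fun m => val (Fin (Multiset.toFinsupp.symm m).toList.length)
    (Multiset.toFinsupp.symm m).toList.get
  refine ⟨(MvPolynomial.basisMonomials τ F).constr F v, ?_⟩
  intro H _ _ a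
  rw [prod_X_eq]
  refine ((MvPolynomial.basisMonomials τ F).constr_basis F v _).trans ?_
  simp only [v]
  have hm : Multiset.toFinsupp.symm (Multiset.toFinsupp ((univ : Finset H).val.map a)) =
    (univ : Finset H).val.map a := by simp
  generalize Multiset.toFinsupp.symm (Multiset.toFinsupp ((univ : Finset H).val.map a)) = mm at hm
  obtain ⟨e, he⟩ := exists_equiv_of_map (τ := τ) mm.toList.get a (by
    rw [← hm]
    conv_rhs => rw [← Multiset.coe_toList mm]
    rw [Fin.univ_val_map, List.ofFn_get])
  rw [he, hval]

end lin
end PF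

namespace PF
open Equiv Finset

section haar
variable {F : Type} [Field F]

lemma monomial_eq_prod {τ : Type} (m : τ →₀ ℕ) : ∃ (n : ℕ) (a : Fin n → τ),
    (MvPolynomial.monomial m (1 : F)) = ∏ h, MvPolynomial.X (a h) := by
  classical
  refine ⟨(Multiset.toFinsupp.symm m).toList.length, (Multiset.toFinsupp.symm m).toList.get, ?_⟩
  rw [prod_X_eq, Fin.univ_val_map, List.ofFn_get, Multiset.coe_toList, AddEquiv.apply_symm_apply]

lemma lin_zero {τ N : Type} [AddCommGroup N] [Module F N] (L : MvPolynomial τ F →ₗ[F] N)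
    (h : ∀ (n : ℕ) (a : Fin n → τ), L (∏ h, MvPolynomial.X (a h)) = 0) (r : MvPolynomial τ F) : L r = 0 := by
  have : L = 0 := by
    refine (MvPolynomial.basisMonomials τ F).ext fun m => ?_
    obtain ⟨n, a, ha⟩ := monomial_eq_prod (F := F) m
    rw [MvPolynomial.coe_basisMonomials]
    simp only
    rw [ha, h]; rfl
  rw [this]; rfl

lemma lin_ext {τ N : Type} [AddCommGroup N] [Module F N] (L L' : MvPolynomial τ F →ₗ[F] N)
    (h : ∀ (n : ℕ) (a : Fin n → τ), L (∏ h, MvPolynomial.X (a h)) = L' (∏ h, MvPolynomial.X (a h)))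
    (r : MvPolynomial τ F) : L r = L' r := by
  have := lin_zero (L - L') (fun n a => by rw [LinearMap.sub_apply, h, sub_self]) r
  rwa [LinearMap.sub_apply, sub_eq_zero] at this

variable [CharZero F]

lemma exists_Lam0 (F : Type) [Field F] [CharZero F] (k : ℕ) :
    ∃ L : MvPolynomial (Fin k × Fin k) F →ₗ[F] F,
    ∀ (H : Type) [Fintype H] [DecidableEq H] (a : H → Fin k × Fin k),
      L (∏ h, MvPolynomial.X (a h)) = EE F (fun h => (a h).1) (fun h => (a h).2) := by
  refine exists_lin (τ := Fin k × Fin k) (fun H _ _ a => EE F (fun h => (a h).1) (fun h => (a h).2)) ?_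
  intro H H' _ _ _ _ e a
  exact (EE_congr (F := F) e (fun h => (a h).1) (fun h => (a h).2)).symm

theorem exists_haar (F : Type) [Field F] [CharZero F] (k : ℕ) :
    ∃ (O : Type) (_ : CommRing O) (_ : Algebra F O) (g : Matrix (Fin k) (Fin k) O) (L : O →ₗ[F] F),
      g.transpose * g = 1 ∧ L 1 = 1 ∧ ∀ (H : Type) [Fintype H] [DecidableEq H] (φ ψ : H → Fin k),
        L (∏ h, g (φ h) (ψ h)) = EE F φ ψ := by
  obtain ⟨L, hL⟩ := exists_Lam0 F k
  let B := MvPolynomial (Fin k × Fin k) F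
  let gen : Fin k → Fin k → B := fun p q => ∑ i, MvPolynomial.X (i, p) * MvPolynomial.X (i, q) -
    (if p = q then 1 else 0)
  let I : Ideal B := Ideal.span {x | ∃ p q, x = gen p q}
  have hgen : ∀ p q (r : B), L (r * gen p q) = 0 := by
    intro p q
    refine lin_zero (L ∘ₗ LinearMap.mulRight F (gen p q)) ?_
    intro n a
    simp only [LinearMap.comp_apply, LinearMap.mulRight_apply, gen, mul_sub, Finset.mul_sum, map_sub, map_sum]
    let b : Fin k → Option (Option (Fin n)) → Fin k × Fin k := fun i x =>
      match x with
      | none => (i, p)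
      | some none => (i, q)
      | some (some h) => a h
    let ψ : Option (Option (Fin n)) → Fin k := fun x =>
      match x with
      | none => p
      | some none => q
      | some (some h) => (a h).2
    let e : Sub (none : Option (Option (Fin n))) (some none) ≃ Fin n :=
      { toFun := fun x => match x with
          | ⟨none, h⟩ => absurd rfl h.1
          | ⟨some none, h⟩ => absurd rfl h.2
          | ⟨some (some h), _⟩ => h
        invFun := fun h => ⟨some (some h), by simp, by simp⟩
        left_inv := by
          rintro ⟨x, hx⟩
          match x, hx with
          | none, h => exact absurd rfl h.1
          | some none, h => exact absurd rfl h.2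
          | some (some h), _ => rfl
        right_inv := fun h => rfl }
    have h1 : ∀ i, (∏ h, MvPolynomial.X (a h)) * (MvPolynomial.X (i, p) * MvPolynomial.X (i, q)) =
        (∏ x, MvPolynomial.X (b i x) : B) := by
      intro i
      rw [Fintype.prod_option, Fintype.prod_option]
      simp only [b]
      ring
    have h2 : ∀ i, L (∏ x, MvPolynomial.X (b i x) : B) =
        EE F (ext none (some none) ((fun h => (a h).1) ∘ e) i) ψ := by
      intro i
      rw [hL]
      congr 1
      · funext x
        match x with
        | none => simp [b, ext_a]
        | some none => simp [b, ext_b]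
        | some (some h) => exact (ext_sub _ _ ((fun h => (a h).1) ∘ e) i ⟨some (some h), by simp, by simp⟩).symm
      · funext x
        match x with
        | none => rfl
        | some none => rfl
        | some (some h) => rfl
    simp only [h1, h2]
    rw [EE_contr (by simp)]
    simp only [ψ]
    split_ifs with hpq
    · rw [mul_one, hL, EE_congr e, sub_eq_zero]
      congr 1
      funext x
      rcases x with ⟨x, hx⟩
      match x, hx with
      | none, h => exact absurd rfl h.1
      | some none, h => exact absurd rfl h.2
      | some (some h), _ => rfl
    · simp
  have hI : ∀ x ∈ I, ∀ r : B, L (r * x) = 0 := by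
    intro x hx
    refine Submodule.span_induction (p := fun x _ => ∀ r : B, L (r * x) = 0) ?_ ?_ ?_ ?_ hx
    · rintro _ ⟨p, q, rfl⟩ r; exact hgen p q r
    · simp
    · intro x y _ _ hx hy r; rw [mul_add, map_add, hx, hy, add_zero]
    · intro c x _ hx r; rw [smul_eq_mul, ← mul_assoc]; exact hx _
  let Lq : (B ⧸ I) →ₗ[F] F := (I.restrictScalars F).liftQ L (by
    intro x hx
    have := hI x hx 1
    rwa [one_mul] at this)
  have hLq : ∀ b : B, Lq (Ideal.Quotient.mk I b) = L b := fun b => rfl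
  refine ⟨B ⧸ I, inferInstance, inferInstance, Matrix.of fun i j => Ideal.Quotient.mk I (MvPolynomial.X (i, j)), Lq, ?_, ?_, ?_⟩
  · ext p q
    rw [Matrix.mul_apply, Matrix.one_apply]
    simp only [Matrix.transpose_apply, Matrix.of_apply]
    have h3 : Ideal.Quotient.mk I (gen p q) = 0 :=
      Ideal.Quotient.eq_zero_iff_mem.2 (Ideal.subset_span ⟨p, q, rfl⟩)
    simp only [gen] at h3
    rw [map_sub, map_sum, sub_eq_zero] at h3
    simp only [map_mul] at h3
    rw [h3]
    split_ifs <;> simp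
  · rw [← map_one (Ideal.Quotient.mk I), hLq]
    have := hL (Fin 0) (fun x => x.elim0)
    simpa [EE_empty] using this
  · intro H _ _ φ ψ
    have h4 := hL H (fun h => (φ h, ψ h))
    rw [← hLq, map_prod] at h4
    exact h4

end haar
end PF

namespace PF
open Equiv Finset

section graphs
variable {W H : Type} [Fintype W] [DecidableEq W] [Fintype H] [DecidableEq H]

structure Pres (att : H → W) (M : Perm H) (G : MGraph) where
  w : W ≃ G.V
  j : G.E × Bool ≃ H
  hj : ∀ x, j (x, true) = M (j (x, false))
  he : ∀ x, G.ends x = (w (att (j (x, false))), w (att (j (x, true))))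

lemma Pres.hj' {att : H → W} {M : Perm H} (hM : Mt M) {G : MGraph} (P : Pres att M G) (x : G.E) :
    P.j (x, false) = M (P.j (x, true)) := by
  rw [P.hj, hM.app]

lemma Pres.iso {att : H → W} {M : Perm H} (hM : Mt M) {G G' : MGraph} (P : Pres att M G) (P' : Pres att M G') :
    Nonempty (G.Iso G') := by
  have key : ∀ {G G' : MGraph} (P : Pres att M G) (P' : Pres att M G') (x : G.E),
      (P.j.symm (P'.j ((P'.j.symm (P.j (x, false))).1, false))).1 = x := by
    intro G G' P P' x
    obtain ⟨⟨y, b⟩, hy⟩ := P'.j.surjective (P.j (x, false))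
    rw [← hy, Equiv.symm_apply_apply]
    cases b
    · simp only [hy, Equiv.symm_apply_apply]
    · simp only
      rw [P'.hj' hM, hy, ← P.hj, Equiv.symm_apply_apply]
  refine ⟨⟨P.w.symm.trans P'.w, ⟨fun x => (P'.j.symm (P.j (x, false))).1, fun x => (P.j.symm (P'.j (x, false))).1,
    key P P', key P' P⟩, ?_⟩⟩
  intro x
  obtain ⟨⟨y, b⟩, hy⟩ := P'.j.surjective (P.j (x, false))
  simp only [Equiv.coe_fn_mk]
  rw [← hy, Equiv.symm_apply_apply]
  simp only
  rw [P'.he, P.he]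
  cases b
  · left
    have : P'.j (y, true) = P.j (x, true) := by rw [P.hj, P'.hj, hy]
    simp [hy, this]
  · right
    have : P'.j (y, false) = P.j (x, true) := by rw [P'.hj' hM, hy, P.hj]
    simp [hy, this]

noncomputable def idx : H → Fin (Fintype.card H) := Fintype.equivFin H

lemma idx_inj : Function.Injective (idx : H → _) := (Fintype.equivFin H).injective

noncomputable def gr (att : H → W) (M : Perm H) : MGraph where
  V := W
  E := {h : H // idx h < idx (M h)}
  ends := fun h => (att h, att (M h))

noncomputable def presGr (att : H → W) {M : Perm H} (hM : Mt M) : Pres att M (gr att M) where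
  w := Equiv.refl W
  j :=
    { toFun := fun x => if x.2 then M x.1.1 else x.1.1
      invFun := fun h => if hh : idx h < idx (M h) then (⟨h, hh⟩, false) else (⟨M h, by
        rw [hM.app]
        exact lt_of_le_of_ne (not_lt.1 hh) (fun h' => hM.2 h (idx_inj h'))⟩, true)
      left_inv := by
        rintro ⟨⟨h, hh⟩, b⟩
        cases b
        · simp only [Bool.false_eq_true, if_false]
          rw [dif_pos hh]
        · simp only [if_true]
          have : ¬ (idx (M h) < idx (M (M h))) := by rw [hM.app]; exact not_lt.2 hh.le
          rw [dif_neg this]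
          simp [hM.app]
      right_inv := by
        intro h
        by_cases hh : idx h < idx (M h)
        · simp only [dif_pos hh]; simp
        · simp only [dif_neg hh]; simp [hM.app] }
  hj := fun x => rfl
  he := fun x => rfl

variable {F : Type} [Field F]

noncomputable def theta (f : MGraph → F) (att : H → W) (M : Perm H) : F := f (gr att M)

def IsoInv (f : MGraph → F) : Prop := ∀ G H : MGraph, Nonempty (G.Iso H) → f G = f H

lemma theta_eq {f : MGraph → F} (hf : IsoInv f) {att : H → W} {M : Perm H} (hM : Mt M) {G : MGraph}
    (P : Pres att M G) : theta f att M = f G := hf _ _ ((presGr att hM).iso hM P)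

def Pres.map {W' H' : Type} [Fintype W'] [DecidableEq W'] [Fintype H'] [DecidableEq H']
    {att : H → W} {M : Perm H} {G : MGraph} (P : Pres att M G) (w1 : W ≃ W') (e1 : H ≃ H') (att' : H' → W')
    (h : ∀ x, att' (e1 x) = w1 (att x)) : Pres att' (e1.permCongr M) G where
  w := w1.symm.trans P.w
  j := P.j.trans e1
  hj := fun x => by simp [P.hj]
  he := fun x => by simp [P.he, h]

lemma theta_congr {W' H' : Type} [Fintype W'] [DecidableEq W'] [Fintype H'] [DecidableEq H']
    {f : MGraph → F} (hf : IsoInv f) {att : H → W} {M : Perm H} (hM : Mt M) (w1 : W ≃ W') (e1 : H ≃ H')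
    (att' : H' → W') (h : ∀ x, att' (e1 x) = w1 (att x)) :
    theta f att M = theta f att' (e1.permCongr M) :=
  (theta_eq hf (Mt_congr e1 hM) ((presGr att hM).map w1 e1 att' h)).symm

def presSelf (G : MGraph) : Σ' (M : Perm (G.E × Bool)), PProd (Mt M)
    (Pres (fun x : G.E × Bool => if x.2 then (G.ends x.1).2 else (G.ends x.1).1) M G) :=
  ⟨⟨fun x => (x.1, !x.2), fun x => (x.1, !x.2), fun x => by simp, fun x => by simp⟩,
    ⟨by ext x <;> simp, fun x h => by
      have := congrArg Prod.snd h
      simp at this⟩,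
    ⟨Equiv.refl _, Equiv.refl _, fun x => rfl, fun x => rfl⟩⟩

/-- degree vector -/
def dg {k : ℕ} (att : H → W) (φ : H → Fin k) (w : W) : Fin k → ℕ :=
  fun c => ∑ h, if att h = w ∧ φ h = c then 1 else 0

lemma pf_pres {C : Type} [CommRing C] {k : ℕ} (y : (Fin k → ℕ) → C) {att : H → W} {M : Perm H} (hM : Mt M)
    {G : MGraph} (P : Pres att M G) :
    G.pf k y = ∑ φ : H → Fin k, if Comp φ M then ∏ w, y (dg att φ w) else 0 := by
  rw [← Finset.sum_filter, MGraph.pf]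
  refine Finset.sum_bij' (fun κ _ => fun h => κ (P.j.symm h).1) (fun φ _ => fun x => φ (P.j (x, false)))
    ?_ (by simp) ?_ ?_ ?_
  · intro κ _
    rw [mem_filter]
    refine ⟨mem_univ _, fun h => ?_⟩
    obtain ⟨⟨x, b⟩, rfl⟩ := P.j.surjective h
    cases b
    · rw [← P.hj]; simp
    · rw [← P.hj' hM]; simp
  · intro κ _; funext x; simp
  · intro φ hφ
    rw [mem_filter] at hφ
    funext h
    obtain ⟨⟨x, b⟩, rfl⟩ := P.j.surjective h
    cases b
    · simp
    · simp only [Equiv.symm_apply_apply]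
      rw [P.hj, hφ.2]
  · intro κ _
    rw [← Equiv.prod_comp P.w]
    refine Finset.prod_congr rfl fun w _ => ?_
    congr 1
    funext c
    rw [MGraph.degVec, dg, ← Equiv.sum_comp P.j, Fintype.sum_prod_type]
    refine Finset.sum_congr rfl fun x _ => ?_
    rw [Fintype.sum_bool]
    simp only [MGraph.inc, P.he, Equiv.symm_apply_apply, EmbeddingLike.apply_eq_iff_eq]
    by_cases hc : κ x = c
    · simp [hc, add_comm]
    · simp [hc]

end graphs
end PF

namespace PF
open Equiv Finset

section galt
variable {W H : Type} [Fintype W] [DecidableEq W] [Fintype H] [DecidableEq H]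
variable {F : Type} [Field F] [CharZero F]

def AltG (k : ℕ) (f : MGraph → F) : Prop :=
  ∀ (G : MGraph) (U : Finset G.V), U.card = k + 1 → ∀ s : {v // v ∈ U} → G.V,
          ∑ π : Equiv.Perm {v // v ∈ U},
            ((Equiv.Perm.sign π : ℤ) : F) * f (G.addEdges U (s ∘ π)) = 0

lemma alt_theta {k : ℕ} {f : MGraph → F} (hf : IsoInv f) (ha : AltG k f) (att : H → W) :
    AltF k (theta f att) := by
  intro S hS M hM
  by_cases h1 : ∃ h ∈ S, M h ∈ S
  · obtain ⟨h, hh, hMh⟩ := h1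
    have hne : h ≠ M h := (hM.2 h).symm
    refine Finset.sum_involution (fun π _ => swap h (M h) * π) ?_ ?_ ?_ ?_
    · intro π hπ
      rw [sg_mul, sg_swap hne]
      have : (swap h (M h) * π)⁻¹ * M * (swap h (M h) * π) = π⁻¹ * M * π := by
        have h2 : swap (M h) (M (M h)) = M * swap h (M h) * M⁻¹ := Equiv.swap_apply_apply M h (M h)
        rw [hM.app, swap_comm] at h2
        have h3 : (swap h (M h))⁻¹ * M * swap h (M h) = M := by
          rw [swap_inv]
          nth_rewrite 1 [h2]
          calc M * swap h (M h) * M⁻¹ * M * swap h (M h) = M * (swap h (M h) * swap h (M h)) := by group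
            _ = M := by rw [swap_mul_self, mul_one]
        calc (swap h (M h) * π)⁻¹ * M * (swap h (M h) * π)
            = π⁻¹ * ((swap h (M h))⁻¹ * M * swap h (M h)) * π := by group
          _ = _ := by rw [h3]
      rw [this]; ring
    · intro π hπ _ h'
      have : swap h (M h) = 1 := mul_right_cancel (h'.trans (one_mul π).symm)
      exact hne (swap_eq_one_iff.1 this)
    · intro π hπ; exact mul_mem_PS (swap_mem_PS hh hMh) hπ
    · intro π hπ; rw [← mul_assoc, swap_mul_self, one_mul]
  push Not at h1
  by_cases h2 : ∃ x ∈ S, ∃ y ∈ S, x ≠ y ∧ att x = att y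
  · obtain ⟨x, hx, y, hy, hxy, he⟩ := h2
    refine Finset.sum_involution (fun π _ => π * swap x y) ?_ ?_ ?_ ?_
    · intro π hπ
      rw [sg_mul, sg_swap hxy]
      have : theta f att ((π * swap x y)⁻¹ * M * (π * swap x y)) = theta f att (π⁻¹ * M * π) := by
        rw [theta_congr hf (hM.conj π) (Equiv.refl W) (swap x y) att]
        · congr 1
        · intro z
          by_cases h1 : z = x
          · rw [h1, swap_apply_left]; exact he.symm
          by_cases h2 : z = y
          · rw [h2, swap_apply_right]; exact he
          rw [swap_apply_of_ne_of_ne h1 h2]; rfl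
      rw [this]; ring
    · intro π hπ _ h'
      have : swap x y = 1 := mul_left_cancel (h'.trans (mul_one π).symm)
      exact hxy (swap_eq_one_iff.1 this)
    · intro π hπ; exact mul_mem_PS hπ (swap_mem_PS hx hy)
    · intro π hπ; rw [mul_assoc, swap_mul_self, mul_one]
  push Not at h2
  -- main case
  have hinj : Set.InjOn att S := by
    intro x hx y hy hxy
    by_contra h; exact h2 x hx y hy h hxy
  let H0 := {h : H // h ∉ S ∧ M h ∉ S}
  have hH0 : ∀ x, (M x ∉ S ∧ M (M x) ∉ S) ↔ (x ∉ S ∧ M x ∉ S) := by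
    intro x; rw [hM.app]; tauto
  let M0 : Perm H0 := M.subtypePerm hH0
  have hM0 : Mt M0 := by
    refine ⟨?_, ?_⟩
    · ext x
      show (M (M x) : H) = x
      exact hM.app _
    · intro x hx
      exact hM.2 x (congrArg Subtype.val hx)
  let G0 : MGraph := gr (fun h : H0 => att h) M0
  let P0 : Pres (fun h : H0 => att h) M0 G0 := presGr _ hM0
  let U : Finset G0.V := (S.image att : Finset W)
  have hU : U.card = k + 1 := by
    rw [← hS]; exact Finset.card_image_of_injOn hinj
  let eSU : S ≃ {v // v ∈ U} := Equiv.ofBijective (fun x => ⟨att x, by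
      show att x ∈ S.image att
      exact mem_image_of_mem _ x.2⟩) (by
    constructor
    · intro x y hxy
      exact Subtype.ext (hinj x.2 y.2 (congrArg Subtype.val hxy))
    · rintro ⟨v, hv⟩
      obtain ⟨x, hx, rfl⟩ := mem_image.1 hv
      exact ⟨⟨x, hx⟩, rfl⟩)
  have heSU : ∀ x : S, ((eSU x).1 : W) = att x := fun x => rfl
  have heSU' : ∀ u, att (eSU.symm u) = u.1 := fun u => by
    rw [← heSU]; rw [Equiv.apply_symm_apply]
  let s : {v // v ∈ U} → G0.V := fun u => att (M (eSU.symm u))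
  have key := ha G0 U hU s
  rw [← key]
  symm
  refine Finset.sum_bij (fun p _ => Perm.ofSubtype (eSU.symm.permCongr p)) ?_ ?_ ?_ ?_
  · intro p _
    rw [mem_PS]
    intro x hx
    exact Perm.ofSubtype_apply_of_not_mem _ hx
  · intro p _ p' _ h
    exact (eSU.symm.permCongr).injective (Perm.ofSubtype_injective h)
  · intro π hπ
    have hs : ∀ x, π x ∈ S ↔ x ∈ S := fun x => ⟨fun h => by
      have := PS_apply_mem (inv_mem_PS hπ) h; simpa using this, PS_apply_mem hπ⟩
    refine ⟨eSU.permCongr (π.subtypePerm hs), mem_univ _, ?_⟩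
    have : eSU.symm.permCongr (eSU.permCongr (π.subtypePerm hs)) = π.subtypePerm hs := by
      ext x; simp
    rw [this]
    refine Perm.ofSubtype_subtypePerm hs ?_
    intro x hx
    by_contra h'
    exact hx (mem_PS.1 hπ x h')
  · intro p _
    set π : Perm H := Perm.ofSubtype (eSU.symm.permCongr p) with hπ
    have hsg : (sg π : F) = ((Perm.sign p : ℤ) : F) := by
      rw [sg, hπ, Perm.sign_ofSubtype, Perm.sign_permCongr]
    rw [hsg]
    congr 1
    have hπS : π ∈ PS S := by
      rw [mem_PS]
      intro x hx
      exact Perm.ofSubtype_apply_of_not_mem _ hx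
    have hπu : ∀ u, π (eSU.symm u) = eSU.symm (p u) := by
      intro u
      have h3 : π (eSU.symm u) = (eSU.symm.permCongr p) (eSU.symm u) := Perm.ofSubtype_apply_coe _ _
      rw [h3]; simp [Equiv.permCongr_apply]
    have hMS : ∀ x, x ∈ S → π⁻¹ (M x) = M x := fun x hx => mem_PS.1 (inv_mem_PS hπS) _ (h1 x hx)
    set M' := π⁻¹ * M * π with hM'
    have hMt' : Mt M' := hM.conj π
    have hM'S : ∀ u, M' (eSU.symm u) = M (eSU.symm (p u)) := by
      intro u
      show π⁻¹ (M (π (eSU.symm u))) = _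
      rw [hπu]
      exact hMS _ (eSU.symm (p u)).2
    have hM'0 : ∀ x : H0, M' x = M x := by
      intro x
      show π⁻¹ (M (π x)) = _
      rw [mem_PS.1 hπS _ x.2.1, mem_PS.1 (inv_mem_PS hπS) _ x.2.2]
    let jf : (G0.E ⊕ {v // v ∈ U}) × Bool → H := fun x =>
      match x with
      | (Sum.inl y, b) => (P0.j (y, b) : H)
      | (Sum.inr u, false) => eSU.symm u
      | (Sum.inr u, true) => M (eSU.symm (p u))
    have hjb : Function.Bijective jf := by
      constructor
      · rintro ⟨y | u, b⟩ ⟨y' | u', b'⟩ h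
        · have := P0.j.injective (Subtype.ext h)
          simp only [Prod.mk.injEq] at this
          rw [this.1, this.2]
        · exfalso
          cases b'
          · have h4 : (P0.j (y, b) : H) = eSU.symm u' := h
            exact (P0.j (y, b)).2.1 (h4 ▸ (eSU.symm u').2)
          · have h4 : (P0.j (y, b) : H) = M (eSU.symm (p u')) := h
            have := (P0.j (y, b)).2.2
            rw [h4, hM.app] at this
            exact this (eSU.symm (p u')).2
        · exfalso
          cases b
          · have h4 : (eSU.symm u : H) = (P0.j (y', b') : H) := h
            exact (P0.j (y', b')).2.1 (h4 ▸ (eSU.symm u).2)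
          · have h4 : M (eSU.symm (p u)) = (P0.j (y', b') : H) := h
            have := (P0.j (y', b')).2.2
            rw [← h4, hM.app] at this
            exact this (eSU.symm (p u)).2
        · cases b <;> cases b'
          · have : eSU.symm u = eSU.symm u' := Subtype.ext h
            rw [eSU.symm.injective this]
          · exfalso
            have h4 : (eSU.symm u : H) = M (eSU.symm (p u')) := h
            exact h1 _ (eSU.symm (p u')).2 (h4 ▸ (eSU.symm u).2)
          · exfalso
            have h4 : M (eSU.symm (p u)) = (eSU.symm u' : H) := h
            exact h1 _ (eSU.symm (p u)).2 (h4 ▸ (eSU.symm u').2)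
          · have : eSU.symm (p u) = eSU.symm (p u') := Subtype.ext (M.injective h)
            rw [p.injective (eSU.symm.injective this)]
      · intro h
        by_cases hh : h ∈ S
        · exact ⟨(Sum.inr (eSU ⟨h, hh⟩), false), by simp [jf]⟩
        by_cases hh' : M h ∈ S
        · exact ⟨(Sum.inr (p.symm (eSU ⟨M h, hh'⟩)), true), by simp [jf, hM.app]⟩
        · obtain ⟨⟨y, b⟩, hy⟩ := P0.j.surjective ⟨h, hh, hh'⟩
          exact ⟨(Sum.inl y, b), by simp [jf, hy]⟩
    let P : Pres att M' (G0.addEdges U (s ∘ p)) :=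
      { w := Equiv.refl W
        j := Equiv.ofBijective jf hjb
        hj := by
          rintro (y | u)
          · show (P0.j (y, true) : H) = M' (P0.j (y, false))
            rw [hM'0, P0.hj]; rfl
          · show M (eSU.symm (p u)) = M' (eSU.symm u)
            rw [hM'S]
        he := by
          rintro (y | u)
          · exact P0.he y
          · show ((u.1 : W), att (M (eSU.symm (p u)))) = (att (eSU.symm u), att (M (eSU.symm (p u))))
            rw [heSU']; rfl }
    exact (theta_eq hf hMt' P).symm

end galt
end PF

namespace PF
open Equiv Finset

section act
variable {W H : Type} [Fintype W] [DecidableEq W] [Fintype H] [DecidableEq H]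
variable {C : Type} [CommRing C] {k : ℕ}

noncomputable def evl (y : (Fin k → ℕ) → C) : MvPolynomial (Fin k) C →ₗ[C] C :=
  (MvPolynomial.basisMonomials (Fin k) C).constr C (fun m => y ⇑m)

lemma evl_monomial (y : (Fin k → ℕ) → C) (m : Fin k →₀ ℕ) : evl y (MvPolynomial.monomial m 1) = y m := by
  have := (MvPolynomial.basisMonomials (Fin k) C).constr_basis C (fun m => y ⇑m) m
  rw [MvPolynomial.coe_basisMonomials] at this
  exact this

noncomputable def act (g : Matrix (Fin k) (Fin k) C) (y : (Fin k → ℕ) → C) (α : Fin k → ℕ) : C :=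
  evl y (∏ i, (∑ c, MvPolynomial.C (g i c) * MvPolynomial.X c) ^ (α i))

def dg1 (φ : H → Fin k) : Fin k → ℕ := fun c => ∑ h, if φ h = c then 1 else 0

lemma prod_dg1 {N : Type} [CommMonoid N] (P : Fin k → N) (φ : H → Fin k) : ∏ i, P i ^ dg1 φ i = ∏ h, P (φ h) := by
  simp only [dg1, ← Finset.prod_pow_eq_pow_sum]
  rw [Finset.prod_comm]
  refine Finset.prod_congr rfl fun h _ => ?_
  simp [pow_ite]

lemma evl_prod (y : (Fin k → ℕ) → C) (ψ : H → Fin k) : evl y (∏ h, MvPolynomial.X (ψ h)) = y (dg1 ψ) := by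
  have : (∏ h, MvPolynomial.X (ψ h) : MvPolynomial (Fin k) C) =
      MvPolynomial.monomial (∑ h, Finsupp.single (ψ h) 1) 1 := by
    rw [MvPolynomial.monomial_sum_one]; rfl
  rw [this, evl_monomial]
  congr 1
  funext c
  simp [dg1, Finsupp.finsetSum_apply, Finsupp.single_apply]

lemma act_dg1 (g : Matrix (Fin k) (Fin k) C) (y : (Fin k → ℕ) → C) (φ : H → Fin k) :
    act g y (dg1 φ) = ∑ ψ : H → Fin k, (∏ h, g (φ h) (ψ h)) * y (dg1 ψ) := by
  rw [act, prod_dg1 (fun i => ∑ c, MvPolynomial.C (g i c) * MvPolynomial.X c) φ, Finset.prod_univ_sum,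
    Fintype.piFinset_univ, map_sum]
  refine Finset.sum_congr rfl fun ψ _ => ?_
  rw [Finset.prod_mul_distrib, ← map_prod, ← MvPolynomial.smul_eq_C_mul, map_smul, evl_prod, smul_eq_mul]

lemma exists_dg1 (α : Fin k → ℕ) : dg1 (fun x : (Σ i, Fin (α i)) => x.1) = α := by
  funext c
  simp only [dg1]
  rw [Fintype.sum_sigma]
  rw [Finset.sum_eq_single c]
  · simp
  · intro b _ hb; simp [hb]
  · simp

lemma act_act (g h : Matrix (Fin k) (Fin k) C) (y : (Fin k → ℕ) → C) : act g (act h y) = act (g * h) y := by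
  funext α
  rw [← exists_dg1 α]
  simp only [act_dg1]
  simp only [Finset.mul_sum]
  rw [Finset.sum_comm]
  refine Finset.sum_congr rfl fun χ _ => ?_
  simp only [← mul_assoc, ← Finset.sum_mul, ← Finset.prod_mul_distrib]
  congr 1
  simp only [Matrix.mul_apply]
  rw [Finset.prod_univ_sum, Fintype.piFinset_univ]

lemma act_one (y : (Fin k → ℕ) → C) : act 1 y = y := by
  funext α
  rw [← exists_dg1 α, act_dg1]
  rw [Finset.sum_eq_single (fun x => x.1)]
  · simp
  · intro ψ _ hψ
    have : ∃ h, ψ h ≠ h.1 := by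
      by_contra! h'
      exact hψ (funext h')
    obtain ⟨h, hh⟩ := this
    have h0 : (1 : Matrix (Fin k) (Fin k) C) h.1 (ψ h) = 0 := Matrix.one_apply_ne hh.symm
    rw [Finset.prod_eq_zero (i := h) (mem_univ h) h0, zero_mul]
  · simp

lemma dg_eq_dg1 (att : H → W) (φ : H → Fin k) (w : W) :
    dg att φ w = dg1 (fun h : {h // att h = w} => φ h) := by
  funext c
  simp only [dg, dg1]
  simp only [ite_and]
  rw [← Finset.sum_filter, Finset.sum_subtype (p := fun h => att h = w) _ (by simp)]

lemma exp_act (g : Matrix (Fin k) (Fin k) C) (y : (Fin k → ℕ) → C) (att : H → W) (φ : H → Fin k) :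
    ∏ w, act g y (dg att φ w) = ∑ ψ : H → Fin k, (∏ h, g (φ h) (ψ h)) * ∏ w, y (dg att ψ w) := by
  simp only [dg_eq_dg1, act_dg1]
  rw [Finset.prod_univ_sum, Fintype.piFinset_univ]
  let e : (H → Fin k) ≃ (∀ w, {h // att h = w} → Fin k) :=
    { toFun := fun ψ w h => ψ h
      invFun := fun x h => x (att h) ⟨h, rfl⟩
      left_inv := fun ψ => rfl
      right_inv := fun x => by
        funext w ⟨h, hh⟩
        subst hh; rfl }
  rw [← Equiv.sum_comp e]
  refine Finset.sum_congr rfl fun ψ _ => ?_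
  rw [Finset.prod_mul_distrib]
  congr 1
  rw [← Equiv.prod_comp (Equiv.sigmaFiberEquiv att), Fintype.prod_sigma]
  rfl

lemma orth_sum {g : Matrix (Fin k) (Fin k) C} (hg : g.transpose * g = 1) {M : Perm H} (hM : Mt M)
    (ψ : H → Fin k) : ∑ φ : H → Fin k, (if Comp φ M then ∏ h, g (φ h) (ψ h) else 0) =
      if Comp ψ M then 1 else 0 := by
  let P := presGr (fun h : H => h) hM
  have h1 : ∑ φ : H → Fin k, (if Comp φ M then ∏ h, g (φ h) (ψ h) else 0) =
      ∑ κ : (gr (fun h : H => h) M).E → Fin k, ∏ x, g (κ x) (ψ (P.j (x, true))) * g (κ x) (ψ (P.j (x, false))) := by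
    rw [← Finset.sum_filter]
    symm
    refine Finset.sum_bij' (fun κ _ => fun h => κ (P.j.symm h).1) (fun φ _ => fun x => φ (P.j (x, false)))
      ?_ (by simp) ?_ ?_ ?_
    · intro κ _
      rw [mem_filter]
      refine ⟨mem_univ _, fun h => ?_⟩
      obtain ⟨⟨x, b⟩, rfl⟩ := P.j.surjective h
      cases b
      · rw [← P.hj]; simp
      · rw [← P.hj' hM]; simp
    · intro κ _; funext x; simp
    · intro φ hφ
      rw [mem_filter] at hφ
      funext h
      obtain ⟨⟨x, b⟩, rfl⟩ := P.j.surjective h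
      cases b
      · simp
      · simp only [Equiv.symm_apply_apply]
        rw [P.hj, hφ.2]
    · intro κ _
      rw [← Equiv.prod_comp P.j, Fintype.prod_prod_type]
      refine Finset.prod_congr rfl fun x _ => ?_
      rw [Fintype.prod_bool]
      simp
  rw [h1]
  have h2 : ∀ x : (gr (fun h : H => h) M).E, ∑ c, g c (ψ (P.j (x, true))) * g c (ψ (P.j (x, false))) =
      if ψ (P.j (x, true)) = ψ (P.j (x, false)) then 1 else 0 := by
    intro x
    have := congrFun (congrFun hg (ψ (P.j (x, true)))) (ψ (P.j (x, false)))
    rw [Matrix.mul_apply, Matrix.one_apply] at this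
    rw [← this]
    rfl
  have h3 := Finset.prod_univ_sum (fun _ : (gr (fun h : H => h) M).E => (univ : Finset (Fin k)))
    (fun x c => g c (ψ (P.j (x, true))) * g c (ψ (P.j (x, false))))
  rw [Fintype.piFinset_univ] at h3
  rw [← h3]
  simp only [h2]
  rw [Finset.prod_ite_zero]
  simp only [Finset.prod_const_one]
  congr 1
  apply propext
  constructor
  · intro h x
    obtain ⟨⟨x, b⟩, rfl⟩ := P.j.surjective x
    cases b
    · rw [← P.hj]; exact h x (mem_univ _)
    · rw [← P.hj' hM]; exact (h x (mem_univ _)).symm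
  · intro h x _
    rw [P.hj]; exact h _

lemma pf_act {g : Matrix (Fin k) (Fin k) C} (hg : g.transpose * g = 1) (y : (Fin k → ℕ) → C) (G : MGraph) :
    G.pf k (act g y) = G.pf k y := by
  obtain ⟨M, hM, P⟩ := presSelf G
  rw [pf_pres _ hM P, pf_pres _ hM P]
  simp only [exp_act]
  have : ∀ φ : G.E × Bool → Fin k, ∀ t : C, (if Comp φ M then t else 0) = (if Comp φ M then 1 else 0) * t := by
    intro φ t; split_ifs <;> simp
  rw [Finset.sum_congr rfl (fun φ _ => this φ _)]
  simp only [Finset.mul_sum]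
  rw [Finset.sum_comm]
  refine Finset.sum_congr rfl fun ψ _ => ?_
  rw [this ψ, ← orth_sum hg hM ψ, Finset.sum_mul]
  refine Finset.sum_congr rfl fun φ _ => ?_
  split_ifs <;> simp

lemma pf_map {D : Type} [CommRing D] (θ : C →+* D) (y : (Fin k → ℕ) → C) (G : MGraph) :
    θ (G.pf k y) = G.pf k (fun α => θ (y α)) := by
  simp [MGraph.pf, map_sum, map_prod]

lemma act_map {D : Type} [CommRing D] (θ : C →+* D) (g : Matrix (Fin k) (Fin k) C) (y : (Fin k → ℕ) → C)
    (α : Fin k → ℕ) : θ (act g y α) = act (g.map θ) (fun α => θ (y α)) α := by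
  rw [← exists_dg1 α, act_dg1, act_dg1]
  simp [map_sum, map_prod]

end act
end PF

namespace PF
open Equiv Finset

section ell
variable {F : Type} [Field F] [CharZero F] {k : ℕ}

noncomputable def so {H : Type} [Fintype H] [DecidableEq H] (k : ℕ) (f : Perm H → F) (φ : H → Fin k) : F := by
  classical
  exact if h : AltF k f then (exists_sol h).choose φ else 0

lemma so_spec {H : Type} [Fintype H] [DecidableEq H] {f : Perm H → F} (h : AltF k f) : IsSol f (so k f) := by
  have : so k f = (exists_sol h).choose := by
    funext φ; simp [so, dif_pos h]
  rw [this]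
  exact (exists_sol h).choose_spec

lemma so_theta_congr {f : MGraph → F} (hf : IsoInv f) (ha : AltG k f)
    {W H W' H' : Type} [Fintype W] [DecidableEq W] [Fintype H] [DecidableEq H]
    [Fintype W'] [DecidableEq W'] [Fintype H'] [DecidableEq H'] (w1 : W ≃ W') (e1 : H ≃ H')
    (att : H → W) (att' : H' → W') (h : ∀ x, att' (e1 x) = w1 (att x)) (φ : H' → Fin k) :
    so k (theta f att') φ = so k (theta f att) (φ ∘ e1) := by
  refine sol_congr e1 ?_ (so_spec (alt_theta hf ha att)) (so_spec (alt_theta hf ha att')) φ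
  intro M hM
  exact theta_congr hf hM w1 e1 att' h

lemma dg_sigma {W : Type} [Fintype W] [DecidableEq W] (d : W → Fin k → ℕ) (w : W) :
    dg (fun x : (Σ p : W × Fin k, Fin (d p.1 p.2)) => x.1.1) (fun x => x.1.2) w = d w := by
  funext c
  simp only [dg]
  rw [Fintype.sum_sigma, Finset.sum_eq_single (w, c)]
  · simp
  · rintro ⟨w', c'⟩ _ hne
    have : ¬ (w' = w ∧ c' = c) := fun h => hne (by rw [h.1, h.2])
    simp [this]
  · simp

lemma exists_fib {W H H' : Type} [Fintype W] [DecidableEq W] [Fintype H] [DecidableEq H]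
    [Fintype H'] [DecidableEq H'] (att : H → W) (φ : H → Fin k) (att' : H' → W) (φ' : H' → Fin k)
    (h : ∀ w, dg att φ w = dg att' φ' w) : ∃ e : H ≃ H', (∀ x, att' (e x) = att x) ∧ φ' ∘ e = φ := by
  obtain ⟨e, he⟩ := exists_equiv_of_map (fun x => (att x, φ x)) (fun x => (att' x, φ' x)) (by
    ext ⟨w, c⟩
    have h1 := congrFun (h w) c
    simp only [dg] at h1
    rw [Finset.sum_boole, Finset.sum_boole] at h1
    rw [Multiset.count_map, Multiset.count_map]
    simp only [Nat.cast_id] at h1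
    simp only [Prod.mk.injEq, eq_comm (a := w), eq_comm (a := c)]
    exact h1)
  refine ⟨e, fun x => ?_, funext fun x => ?_⟩
  · exact (congrArg Prod.fst (congrFun he x)).symm
  · exact (congrArg Prod.snd (congrFun he x)).symm

lemma exists_ell {f : MGraph → F} (hf : IsoInv f) (ha : AltG k f) :
    ∃ L : MvPolynomial (Fin k → ℕ) F →ₗ[F] F, ∀ (W H : Type) [Fintype W] [DecidableEq W] [Fintype H]
      [DecidableEq H] (att : H → W) (φ : H → Fin k),
      L (∏ w, MvPolynomial.X (dg att φ w)) = so k (theta f att) φ := by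
  obtain ⟨L, hL⟩ := exists_lin (F := F) (τ := Fin k → ℕ) (fun W _ _ d =>
    so k (theta f (fun x : (Σ p : W × Fin k, Fin (d p.1 p.2)) => x.1.1)) (fun x => x.1.2)) (by
    intro W W' _ _ _ _ e a
    let e1 : (Σ p : W × Fin k, Fin ((a ∘ e) p.1 p.2)) ≃ (Σ p : W' × Fin k, Fin (a p.1 p.2)) :=
      Equiv.sigmaCongr (Equiv.prodCongr e (Equiv.refl _)) (fun p => Equiv.refl _)
    exact (so_theta_congr hf ha e e1 (fun x => x.1.1) (fun x => x.1.1) (fun x => rfl) (fun x => x.1.2)).symm)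
  refine ⟨L, ?_⟩
  intro W H _ _ _ _ att φ
  rw [hL W]
  obtain ⟨e, h1, h2⟩ := exists_fib att φ
    (fun x : (Σ p : W × Fin k, Fin (dg att φ p.1 p.2)) => x.1.1) (fun x => x.1.2)
    (fun w => (dg_sigma _ w).symm)
  rw [so_theta_congr hf ha (Equiv.refl W) e att _ (fun x => h1 x), h2]

lemma ell_pf {f : MGraph → F} (hf : IsoInv f) (ha : AltG k f) {L : MvPolynomial (Fin k → ℕ) F →ₗ[F] F}
    (hL : ∀ (W H : Type) [Fintype W] [DecidableEq W] [Fintype H]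
      [DecidableEq H] (att : H → W) (φ : H → Fin k),
      L (∏ w, MvPolynomial.X (dg att φ w)) = so k (theta f att) φ) (G : MGraph) :
    L (G.pf k MvPolynomial.X) = f G := by
  obtain ⟨M, hM, P⟩ := presSelf G
  rw [pf_pres _ hM P, map_sum]
  rw [← theta_eq hf hM P, ← (so_spec (alt_theta hf ha _)).2 M hM]
  refine Finset.sum_congr rfl fun φ _ => ?_
  simp only [ind]
  split_ifs
  · rw [hL, mul_one]
  · simp

lemma pf_mul {C : Type} [CommRing C] (y : (Fin k → ℕ) → C) (G H : MGraph) :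
    (G.disjUnion H).pf k y = G.pf k y * H.pf k y := by
  simp only [MGraph.pf]
  rw [Finset.sum_mul_sum, ← Fintype.sum_prod_type']
  refine (Equiv.sum_comp (Equiv.sumArrowEquivProdArrow G.E H.E (Fin k)).symm
    (fun κ => ∏ v, y ((G.disjUnion H).degVec κ v))).symm.trans ?_
  refine Finset.sum_congr rfl fun κ _ => ?_
  refine (Fintype.prod_sum_type _).trans ?_
  congr 1
  · refine Finset.prod_congr rfl fun v _ => ?_
    congr 1; funext c
    simp only [MGraph.degVec]
    refine (Fintype.sum_sum_type _).trans ?_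
    simp [MGraph.inc, MGraph.disjUnion, Equiv.sumArrowEquivProdArrow]
  · refine Finset.prod_congr rfl fun v _ => ?_
    congr 1; funext c
    simp only [MGraph.degVec]
    refine (Fintype.sum_sum_type _).trans ?_
    simp [MGraph.inc, MGraph.disjUnion, Equiv.sumArrowEquivProdArrow]

lemma pf_empty {C : Type} [CommRing C] (y : (Fin k → ℕ) → C) : MGraph.empty.pf k y = 1 := by
  simp only [MGraph.pf]
  have hh : ∀ κ : MGraph.empty.E → Fin k, ∏ v : MGraph.empty.V, y (MGraph.empty.degVec κ v) = 1 := by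
    intro κ
    have : IsEmpty MGraph.empty.V := inferInstanceAs (IsEmpty Empty)
    exact Finset.prod_of_isEmpty _
  have : IsEmpty MGraph.empty.E := inferInstanceAs (IsEmpty Empty)
  rw [Finset.sum_congr rfl (fun κ _ => hh κ)]
  simp

lemma pf_alt {C : Type} [CommRing C] (y : (Fin k → ℕ) → C) (G : MGraph) (U : Finset G.V) (hU : U.card = k + 1)
    (s : {v // v ∈ U} → G.V) : ∑ π : Equiv.Perm {v // v ∈ U},
            ((Equiv.Perm.sign π : ℤ) : C) * (G.addEdges U (s ∘ π)).pf k y = 0 := by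
  have h1 : ∀ π : Equiv.Perm {v // v ∈ U}, (G.addEdges U (s ∘ π)).pf k y =
      ∑ κ : G.E ⊕ {v // v ∈ U} → Fin k, ∏ v : G.V, y ((G.addEdges U (s ∘ π)).degVec κ v) := fun π => rfl
  simp only [h1, Finset.mul_sum]
  rw [Finset.sum_comm]
  refine Finset.sum_eq_zero fun κ _ => ?_
  obtain ⟨u1, u2, hne, hu⟩ := Fintype.exists_ne_map_eq_of_card_lt (fun u : {v // v ∈ U} => κ (Sum.inr u))
    (by rw [Fintype.card_fin, Fintype.card_coe, hU]; omega)
  refine Finset.sum_involution (fun π _ => π * swap u1 u2) ?_ ?_ (by simp) ?_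
  · intro π _
    have h2 : ∀ v : G.V, (G.addEdges U (s ∘ ⇑(π * swap u1 u2))).degVec κ v = (G.addEdges U (s ∘ π)).degVec κ v := by
      intro v
      have h3 : ∀ (t : {v // v ∈ U} → G.V) (c : Fin k), (G.addEdges U t).degVec κ v c =
          (∑ e : G.E, if κ (Sum.inl e) = c then G.inc v e else 0) +
          ((∑ u, if κ (Sum.inr u) = c then (if u.1 = v then 1 else 0) else 0) +
          (∑ u, if κ (Sum.inr u) = c then (if t u = v then 1 else 0) else 0)) := by
        intro t c
        refine (Fintype.sum_sum_type _).trans ?_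
        congr 1
        rw [← Finset.sum_add_distrib]
        refine Finset.sum_congr rfl fun u _ => ?_
        by_cases hc : κ (Sum.inr u) = c
        · simp only [if_pos hc]; rfl
        · simp only [if_neg hc]
      funext c
      rw [h3, h3]
      congr 2
      rw [← Equiv.sum_comp (swap u1 u2)]
      refine Finset.sum_congr rfl fun u _ => ?_
      have h4 : κ (Sum.inr (swap u1 u2 u)) = κ (Sum.inr u) := by
        by_cases h : u = u1
        · rw [h, swap_apply_left]; exact hu.symm
        by_cases h' : u = u2
        · rw [h', swap_apply_right]; exact hu
        rw [swap_apply_of_ne_of_ne h h']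
      rw [h4]
      simp
    have h5 : ∏ v : G.V, y ((G.addEdges U (s ∘ ⇑(π * swap u1 u2))).degVec κ v) =
      ∏ v : G.V, y ((G.addEdges U (s ∘ π)).degVec κ v) := Finset.prod_congr rfl fun v _ => by rw [h2]
    rw [h5, Perm.sign_mul, Perm.sign_swap hne]
    simp
  · intro π _ _ h'
    have : swap u1 u2 = 1 := mul_left_cancel (h'.trans (mul_one π).symm)
    exact hne (swap_eq_one_iff.1 this)
  · intro π _; rw [mul_assoc, swap_mul_self, mul_one]

end ell
end PF

namespace PF
open Equiv Finset

section cm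
variable {τ A B : Type} [CommRing A] [CommRing B]

noncomputable def cm0 (L : A →+ B) (p : MvPolynomial τ A) : MvPolynomial τ B :=
  ∑ m ∈ p.support, MvPolynomial.monomial m (L (p.coeff m))

lemma coeff_cm0 (L : A →+ B) (p : MvPolynomial τ A) (m : τ →₀ ℕ) : (cm0 L p).coeff m = L (p.coeff m) := by
  classical
  rw [cm0, MvPolynomial.coeff_sum]
  simp only [MvPolynomial.coeff_monomial]
  rw [Finset.sum_ite_eq']
  split_ifs with h
  · rfl
  · rw [MvPolynomial.notMem_support_iff.1 h, map_zero]

noncomputable def cm (L : A →+ B) : MvPolynomial τ A →+ MvPolynomial τ B where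
  toFun := cm0 L
  map_zero' := by ext m; simp [coeff_cm0]
  map_add' := fun p q => by ext m; simp [coeff_cm0]

lemma coeff_cm (L : A →+ B) (p : MvPolynomial τ A) (m : τ →₀ ℕ) : (cm L p).coeff m = L (p.coeff m) :=
  coeff_cm0 L p m

lemma cm_C (L : A →+ B) (a : A) : cm L (MvPolynomial.C a : MvPolynomial τ A) = MvPolynomial.C (L a) := by
  classical
  ext m
  rw [coeff_cm, MvPolynomial.coeff_C, MvPolynomial.coeff_C]
  split_ifs <;> simp

lemma cm_mul {L : A →+ B} {i : B →+* A} (h : ∀ b a, L (i b * a) = b * L a) (b : MvPolynomial τ B)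
    (a : MvPolynomial τ A) : cm L (MvPolynomial.map i b * a) = b * cm L a := by
  classical
  ext m
  rw [coeff_cm, MvPolynomial.coeff_mul, MvPolynomial.coeff_mul, map_sum]
  refine Finset.sum_congr rfl fun x _ => ?_
  rw [MvPolynomial.coeff_map, h, coeff_cm]

end cm

section haar
variable (F : Type) [Field F] [CharZero F] (k : ℕ)

structure Haar where
  O : Type
  [ring : CommRing O]
  [alg : Algebra F O]
  g : Matrix (Fin k) (Fin k) O
  L : O →ₗ[F] F
  orth : g.transpose * g = 1
  one : L 1 = 1
  ee : ∀ (H : Type) [Fintype H] [DecidableEq H] (φ ψ : H → Fin k), L (∏ h, g (φ h) (ψ h)) = EE F φ ψ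

attribute [instance] Haar.ring Haar.alg

lemma nonempty_haar : Nonempty (Haar F k) := by
  obtain ⟨O, i1, i2, g, L, h1, h2, h3⟩ := exists_haar F k
  exact ⟨⟨O, g, L, h1, h2, h3⟩⟩

abbrev RR := MvPolynomial (Fin k → ℕ) F
abbrev SS := MvPolynomial (Fin k × Fin k) (RR F k)

variable {F k}
variable (h : Haar F k)

lemma Haar.orth' : h.g * h.g.transpose = 1 := by
  have := h.orth
  rwa [mul_eq_one_comm] at this

abbrev Haar.RO := MvPolynomial (Fin k → ℕ) h.O
abbrev Haar.SO := MvPolynomial (Fin k × Fin k) h.RO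

noncomputable def Haar.i : RR F k →+* h.RO := MvPolynomial.map (algebraMap F h.O)
noncomputable def Haar.gR : Matrix (Fin k) (Fin k) h.RO := h.g.map MvPolynomial.C
noncomputable def Haar.d : RR F k →+* h.RO :=
  MvPolynomial.eval₂Hom (MvPolynomial.C.comp (algebraMap F h.O)) (fun α => act h.gR MvPolynomial.X α)
noncomputable def Haar.LR : h.RO →+ RR F k := cm h.L.toAddMonoidHom

lemma Haar.gR_orth : h.gR.transpose * h.gR = 1 := by
  have := congrArg (fun A => A.map (MvPolynomial.C : h.O →+* h.RO)) h.orth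
  simp only [Matrix.map_mul, Matrix.transpose_map] at this
  rw [Matrix.map_one _ (map_zero _) (map_one _)] at this
  exact this

lemma Haar.gR_orth' : h.gR * h.gR.transpose = 1 := by
  have := h.gR_orth
  rwa [mul_eq_one_comm] at this

/-- the substitution on the matrix variables -/
noncomputable def TT' {C : Type} [CommRing C] (g : Matrix (Fin k) (Fin k) C) :
    MvPolynomial (Fin k × Fin k) C →ₐ[C] MvPolynomial (Fin k × Fin k) C :=
  MvPolynomial.aeval (fun p => ∑ c, MvPolynomial.C (g p.2 c) * MvPolynomial.X (p.1, c))

noncomputable def Haar.i' : SS F k →+* h.SO := MvPolynomial.map h.i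
noncomputable def Haar.d' : SS F k →+* h.SO := (TT' h.gR).toRingHom.comp (MvPolynomial.map h.d)
noncomputable def Haar.LS : h.SO →+ SS F k := cm h.LR

lemma Haar.LR_mul (a : RR F k) (t : h.RO) : h.LR (h.i a * t) = a * h.LR t := by
  refine cm_mul ?_ a t
  intro b x
  show h.L (algebraMap F h.O b * x) = b * h.L x
  rw [← Algebra.smul_def, map_smul, smul_eq_mul]

lemma Haar.LS_mul (a : SS F k) (t : h.SO) : h.LS (h.i' a * t) = a * h.LS t := cm_mul h.LR_mul a t

lemma Haar.LR_C (o : h.O) : h.LR (MvPolynomial.C o) = MvPolynomial.C (h.L o) := cm_C _ _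
lemma Haar.LS_C (o : h.RO) : h.LS (MvPolynomial.C o) = MvPolynomial.C (h.LR o) := cm_C _ _
lemma Haar.LR_one : h.LR 1 = 1 := by
  have := h.LR_C 1
  rwa [h.one, MvPolynomial.C_1, MvPolynomial.C_1] at this

noncomputable def Haar.ρ (r : RR F k) : RR F k := h.LR (h.d r)
noncomputable def Haar.ρ' (r : SS F k) : SS F k := h.LS (h.d' r)

noncomputable def Haar.A : Subalgebra F (RR F k) where
  carrier := {a | h.d a = h.i a}
  mul_mem' := fun {a b} ha hb => by
    simp only [Set.mem_ofPred_eq] at *; rw [map_mul, map_mul, ha, hb]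
  add_mem' := fun {a b} ha hb => by
    simp only [Set.mem_ofPred_eq] at *; rw [map_add, map_add, ha, hb]
  algebraMap_mem' := fun r => by
    simp only [Set.mem_ofPred_eq, MvPolynomial.algebraMap_eq, Haar.d, Haar.i]
    simp

lemma Haar.CC (a : F) : (MvPolynomial.C a : RR F k) ∈ h.A := h.A.algebraMap_mem a

lemma Haar.d'_C (r : RR F k) : h.d' (MvPolynomial.C r) = MvPolynomial.C (h.d r) := by
  simp [Haar.d', TT']

noncomputable def Haar.A' : Subalgebra F (SS F k) where
  carrier := {a | h.d' a = h.i' a}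
  mul_mem' := fun {a b} ha hb => by
    simp only [Set.mem_ofPred_eq] at *; rw [map_mul, map_mul, ha, hb]
  add_mem' := fun {a b} ha hb => by
    simp only [Set.mem_ofPred_eq] at *; rw [map_add, map_add, ha, hb]
  algebraMap_mem' := fun r => by
    have h1 : algebraMap F (SS F k) r = MvPolynomial.C (algebraMap F (RR F k) r) := rfl
    have h2 : h.d (algebraMap F (RR F k) r) = h.i (algebraMap F (RR F k) r) := h.A.algebraMap_mem r
    simp only [Set.mem_ofPred_eq]
    rw [h1, h.d'_C, h2, Haar.i', MvPolynomial.map_C]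

lemma Haar.mem_A {a : RR F k} : a ∈ h.A ↔ h.d a = h.i a := Iff.rfl
lemma Haar.mem_A' {a : SS F k} : a ∈ h.A' ↔ h.d' a = h.i' a := Iff.rfl

lemma Haar.ρ_mul {a : RR F k} (ha : a ∈ h.A) (b : RR F k) : h.ρ (a * b) = a * h.ρ b := by
  rw [Haar.ρ, map_mul, h.mem_A.1 ha, h.LR_mul]; rfl

lemma Haar.ρ'_mul {a : SS F k} (ha : a ∈ h.A') (b : SS F k) : h.ρ' (a * b) = a * h.ρ' b := by
  rw [Haar.ρ', map_mul, h.mem_A'.1 ha, h.LS_mul]; rfl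

lemma Haar.ρ_A {a : RR F k} (ha : a ∈ h.A) : h.ρ a = a := by
  have := h.ρ_mul ha 1
  rw [mul_one] at this
  rw [this, Haar.ρ, map_one, h.LR_one, mul_one]

lemma Haar.ρ_add (a b : RR F k) : h.ρ (a + b) = h.ρ a + h.ρ b := by simp [Haar.ρ]
lemma Haar.ρ'_add (a b : SS F k) : h.ρ' (a + b) = h.ρ' a + h.ρ' b := by simp [Haar.ρ']

section mono
variable {W H Q : Type} [Fintype W] [DecidableEq W] [Fintype H] [DecidableEq H] [Fintype Q] [DecidableEq Q]

noncomputable def mono (F : Type) [Field F] (att : H → W) (φ : H → Fin k) : RR F k := ∏ w, MvPolynomial.X (dg att φ w)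

lemma Haar.d_mono (att : H → W) (φ : H → Fin k) :
    h.d (mono F att φ) = ∑ ψ : H → Fin k, MvPolynomial.C (∏ x, h.g (φ x) (ψ x)) * h.i (mono F att ψ) := by
  simp only [mono, Haar.d, map_prod, MvPolynomial.coe_eval₂Hom, MvPolynomial.eval₂_X]
  rw [exp_act]
  simp [Haar.i, Haar.gR]

lemma Haar.ρ_mono (att : H → W) (φ : H → Fin k) :
    h.ρ (mono F att φ) = ∑ ψ : H → Fin k, MvPolynomial.C (EE F φ ψ) * mono F att ψ := by
  rw [Haar.ρ, h.d_mono, map_sum]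
  refine Finset.sum_congr rfl fun ψ _ => ?_
  rw [mul_comm, h.LR_mul, h.LR_C, h.ee, mul_comm]

noncomputable def mono' (F : Type) [Field F] (att : H → W) (b : Q → Fin k) (φ : H ⊕ Q → Fin k) : SS F k :=
  MvPolynomial.C (mono F att (fun x => φ (Sum.inl x))) * ∏ q, MvPolynomial.X (b q, φ (Sum.inr q))

lemma Haar.d'_mono (att : H → W) (b : Q → Fin k) (φ : H ⊕ Q → Fin k) :
    h.d' (mono' F att b φ) = ∑ ψ : H ⊕ Q → Fin k,
      MvPolynomial.C (MvPolynomial.C (∏ x, h.g (φ x) (ψ x))) * h.i' (mono' F att b ψ) := by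
  rw [mono', map_mul, h.d'_C, h.d_mono, map_prod]
  have h1 : ∀ q, h.d' (MvPolynomial.X (b q, φ (Sum.inr q))) =
      ∑ c, MvPolynomial.C (MvPolynomial.C (h.g (φ (Sum.inr q)) c)) * MvPolynomial.X (b q, c) := by
    intro q
    simp [Haar.d', TT', Haar.gR]
  simp only [h1]
  rw [Finset.prod_univ_sum, Fintype.piFinset_univ, map_sum, Finset.sum_mul_sum, ← Fintype.sum_prod_type',
    ← Equiv.sum_comp (Equiv.sumArrowEquivProdArrow H Q (Fin k))]
  refine Finset.sum_congr rfl fun ψ _ => ?_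
  rw [Finset.prod_mul_distrib]
  simp only [mono', map_mul, Fintype.prod_sum_type, map_prod, Haar.i', MvPolynomial.map_C, MvPolynomial.map_X,
    Equiv.sumArrowEquivProdArrow, Equiv.coe_fn_mk, Function.comp_apply]
  have : (ψ ∘ Sum.inl) = fun x => ψ (Sum.inl x) := rfl
  rw [this]
  ring

lemma Haar.ρ'_mono (att : H → W) (b : Q → Fin k) (φ : H ⊕ Q → Fin k) :
    h.ρ' (mono' F att b φ) = ∑ ψ : H ⊕ Q → Fin k, MvPolynomial.C (MvPolynomial.C (EE F φ ψ)) * mono' F att b ψ := by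
  rw [Haar.ρ', h.d'_mono, map_sum]
  refine Finset.sum_congr rfl fun ψ _ => ?_
  rw [mul_comm, h.LS_mul, h.LS_C, h.LR_C, h.ee, mul_comm]

lemma Haar.inv_orth {t : (H → Fin k) → F} (ht : t ∈ Inv F H k) (χ : H → Fin k) :
    ∑ ψ, algebraMap F h.O (t ψ) * ∏ x, h.g (ψ x) (χ x) = algebraMap F h.O (t χ) := by
  refine Submodule.span_induction ?_ ?_ ?_ ?_ ht
  · rintro _ ⟨M, hM, rfl⟩
    have := orth_sum h.orth hM χ
    simp only [ind]
    rw [apply_ite (algebraMap F h.O), map_one, map_zero, ← this]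
    refine Finset.sum_congr rfl fun ψ _ => ?_
    split_ifs <;> simp
  · simp
  · intro a b _ _ ha hb
    simp only [Pi.add_apply, map_add, add_mul, Finset.sum_add_distrib, ha, hb]
  · intro c a _ ha
    simp only [Pi.smul_apply, smul_eq_mul, map_mul, mul_assoc, ← Finset.mul_sum, ha]

lemma Haar.inv_mem_A' (att : H → W) (b : Q → Fin k) {t : (H ⊕ Q → Fin k) → F} (ht : t ∈ Inv F (H ⊕ Q) k) :
    ∑ ψ, MvPolynomial.C (MvPolynomial.C (t ψ)) * mono' F att b ψ ∈ h.A' := by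
  rw [h.mem_A', map_sum, map_sum]
  have h1 : ∀ c : F, h.d' (MvPolynomial.C (MvPolynomial.C c)) = MvPolynomial.C (MvPolynomial.C (algebraMap F h.O c)) := by
    intro c; rw [h.d'_C]; simp [Haar.d]
  have h2 : ∀ c : F, h.i' (MvPolynomial.C (MvPolynomial.C c)) = MvPolynomial.C (MvPolynomial.C (algebraMap F h.O c)) := by
    intro c; simp [Haar.i', Haar.i]
  simp only [map_mul, h1, h2, h.d'_mono, Finset.mul_sum]
  rw [Finset.sum_comm]
  refine Finset.sum_congr rfl fun χ _ => ?_
  rw [← h.inv_orth ht χ]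
  simp only [map_sum, map_mul, Finset.sum_mul, mul_assoc]

lemma Haar.ρ'_mono_mem (att : H → W) (b : Q → Fin k) (φ : H ⊕ Q → Fin k) : h.ρ' (mono' F att b φ) ∈ h.A' := by
  rw [h.ρ'_mono]
  exact h.inv_mem_A' att b (EE_mem' φ)

lemma inv_mem_span (att : H → W) {t : (H → Fin k) → F} (ht : t ∈ Inv F H k) :
    ∑ ψ, MvPolynomial.C (t ψ) * mono F att ψ ∈
      Submodule.span F (Set.range (fun G : MGraph => (G.pf k MvPolynomial.X : RR F k))) := by
  refine Submodule.span_induction ?_ ?_ ?_ ?_ ht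
  · rintro _ ⟨M, hM, rfl⟩
    refine Submodule.subset_span ⟨gr att M, ?_⟩
    simp only
    rw [pf_pres _ hM (presGr att hM)]
    refine Finset.sum_congr rfl fun ψ _ => ?_
    simp only [ind]
    split_ifs
    · simp [mono]
    · simp
  · simp
  · intro a b _ _ ha hb
    simp only [Pi.add_apply, map_add, add_mul, Finset.sum_add_distrib]
    exact add_mem ha hb
  · intro c a _ ha
    simp only [Pi.smul_apply, smul_eq_mul, map_mul, mul_assoc, ← Finset.mul_sum]
    rw [← MvPolynomial.smul_eq_C_mul]
    exact Submodule.smul_mem _ _ ha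

end mono

lemma exists_mono {n : ℕ} (a : Fin n → (Fin k → ℕ)) :
    ∃ (H : Type) (_ : Fintype H) (_ : DecidableEq H) (att : H → Fin n) (φ : H → Fin k),
      mono F att φ = ∏ x, MvPolynomial.X (a x) := by
  refine ⟨(Σ p : Fin n × Fin k, Fin (a p.1 p.2)), inferInstance, inferInstance, fun x => x.1.1, fun x => x.1.2, ?_⟩
  simp only [mono, dg_sigma]

lemma monomial_eq_prod' {C τ : Type} [CommRing C] [Algebra F C] (m : τ →₀ ℕ) : ∃ (n : ℕ) (a : Fin n → τ),
    (MvPolynomial.monomial m (1 : C)) = ∏ h, MvPolynomial.X (a h) := by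
  obtain ⟨n, a, ha⟩ := monomial_eq_prod (F := F) m
  refine ⟨n, a, ?_⟩
  have := congrArg (MvPolynomial.map (algebraMap F C)) ha
  simpa [MvPolynomial.map_monomial, map_prod] using this

lemma Haar.ρ_mem (r : RR F k) : h.ρ r ∈
    Submodule.span F (Set.range (fun G : MGraph => (G.pf k MvPolynomial.X : RR F k))) := by
  induction r using MvPolynomial.induction_on' with
  | monomial u a =>
    obtain ⟨n, b, hb⟩ := monomial_eq_prod (F := F) u
    obtain ⟨H, _, _, att, φ, hφ⟩ := exists_mono (F := F) b
    have h1 : (MvPolynomial.monomial u a : RR F k) = MvPolynomial.C a * mono F att φ := by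
      rw [hφ, ← hb, MvPolynomial.C_mul_monomial, mul_one]
    rw [h1, h.ρ_mul (h.CC a), ← MvPolynomial.smul_eq_C_mul]
    refine Submodule.smul_mem _ _ ?_
    rw [h.ρ_mono]
    exact inv_mem_span att (EE_mem' φ)
  | add p q hp hq =>
    rw [h.ρ_add]; exact add_mem hp hq

lemma Haar.C_mem {a : RR F k} (ha : a ∈ h.A) : MvPolynomial.C a ∈ h.A' := by
  rw [h.mem_A', h.d'_C, h.mem_A.1 ha, Haar.i', MvPolynomial.map_C]

lemma Haar.ρ'_mem (r : SS F k) : h.ρ' r ∈ h.A' := by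
  induction r using MvPolynomial.induction_on' with
  | monomial m r =>
    obtain ⟨n', p, hp⟩ := monomial_eq_prod' (F := F) (C := RR F k) m
    have h0 : (MvPolynomial.monomial m r : SS F k) = MvPolynomial.C r * ∏ x, MvPolynomial.X (p x) := by
      rw [← hp, MvPolynomial.C_mul_monomial, mul_one]
    rw [h0]
    clear h0
    induction r using MvPolynomial.induction_on' with
    | monomial u a =>
      obtain ⟨n, b, hb⟩ := monomial_eq_prod (F := F) u
      obtain ⟨H, _, _, att, φ, hφ⟩ := exists_mono (F := F) b
      have h1 : (MvPolynomial.monomial u a : RR F k) = MvPolynomial.C a * mono F att φ := by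
        rw [hφ, ← hb, MvPolynomial.C_mul_monomial, mul_one]
      have h2 : (MvPolynomial.C (MvPolynomial.monomial u a) * ∏ x, MvPolynomial.X (p x) : SS F k) =
          MvPolynomial.C (MvPolynomial.C a) *
            mono' F att (fun x => (p x).1) (Sum.elim φ (fun x => (p x).2)) := by
        rw [h1, map_mul, mul_assoc]; rfl
      rw [h2, h.ρ'_mul (h.C_mem (h.CC a))]
      exact mul_mem (h.C_mem (h.CC a)) (h.ρ'_mono_mem _ _ _)
    | add p q hp hq =>
      rw [map_add, add_mul, h.ρ'_add]
      exact add_mem hp hq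
  | add p q hp hq =>
    rw [h.ρ'_add]; exact add_mem hp hq

lemma Haar.d_X (α : Fin k → ℕ) : h.d (MvPolynomial.X α) = act h.gR MvPolynomial.X α := by
  simp [Haar.d]
lemma Haar.i_X (α : Fin k → ℕ) : h.i (MvPolynomial.X α) = MvPolynomial.X α := by
  simp [Haar.i]

lemma Haar.pf_mem (G : MGraph) : (G.pf k MvPolynomial.X : RR F k) ∈ h.A := by
  rw [h.mem_A, pf_map, pf_map]
  simp only [h.d_X, h.i_X]
  exact pf_act h.gR_orth _ G

lemma Haar.ρ_mem_A (r : RR F k) : h.ρ r ∈ h.A := by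
  have : Submodule.span F (Set.range (fun G : MGraph => (G.pf k MvPolynomial.X : RR F k))) ≤
    Subalgebra.toSubmodule h.A := by
    rw [Submodule.span_le]
    rintro _ ⟨G, rfl⟩
    exact h.pf_mem G
  exact this (h.ρ_mem r)

lemma Haar.A_le {a : RR F k} (ha : a ∈ h.A) : a ∈
    Submodule.span F (Set.range (fun G : MGraph => (G.pf k MvPolynomial.X : RR F k))) := by
  rw [← h.ρ_A ha]; exact h.ρ_mem a

end haar
end PF

namespace PF
open Equiv Finset

section fieldK
variable {F : Type} [Field F] [CharZero F] {k : ℕ}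

lemma Haar.ell_mul (h : Haar F k) {f : MGraph → F} (hmul : ∀ G H : MGraph, f (G.disjUnion H) = f G * f H)
    {L : RR F k →ₗ[F] F} (hL : ∀ G : MGraph, L (G.pf k MvPolynomial.X) = f G) {a b : RR F k}
    (ha : a ∈ h.A) (hb : b ∈ h.A) : L (a * b) = L a * L b := by
  refine Submodule.span_induction (p := fun a _ => L (a * b) = L a * L b) ?_ ?_ ?_ ?_ (h.A_le ha)
  · rintro _ ⟨G, rfl⟩
    refine Submodule.span_induction (p := fun b _ => L (G.pf k MvPolynomial.X * b) = L (G.pf k MvPolynomial.X) * L b)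
      ?_ ?_ ?_ ?_ (h.A_le hb)
    · rintro _ ⟨G', rfl⟩
      simp only
      rw [← pf_mul, hL, hL, hL, hmul]
    · simp
    · intro x y _ _ hx hy; rw [mul_add, map_add, hx, hy, map_add, mul_add]
    · intro c x _ hx; rw [mul_smul_comm, map_smul, hx, map_smul, smul_eq_mul, smul_eq_mul]; ring
  · simp
  · intro x y _ _ hx hy; rw [add_mul, map_add, hx, hy, map_add, add_mul]
  · intro c x _ hx; rw [smul_mul_assoc, map_smul, hx, map_smul, smul_eq_mul, smul_eq_mul]; ring

theorem Haar.exists_K (h : Haar F k) {f : MGraph → F} (hf : IsoInv f) (ha : AltG k f) (h1 : f MGraph.empty = 1)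
    (hmul : ∀ G H : MGraph, f (G.disjUnion H) = f G * f H) :
    ∃ (L : RR F k →ₗ[F] F) (K : Type) (_ : Field K) (_ : Algebra F K) (ev : RR F k →ₐ[F] K),
      (∀ G : MGraph, L (G.pf k MvPolynomial.X) = f G) ∧
      (∀ a ∈ h.A, ev a = algebraMap F K (L a)) ∧
      (∀ r, (∀ s, L (h.ρ (r * s)) = 0) → ev r = 0) := by
  obtain ⟨L, hL0⟩ := exists_ell hf ha
  have hL := ell_pf hf ha hL0
  have hLm : ∀ a ∈ h.A, ∀ b ∈ h.A, L (a * b) = L a * L b := fun a ha b hb => h.ell_mul hmul hL ha hb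
  have hL1 : L 1 = 1 := by
    have := hL MGraph.empty
    rwa [pf_empty, h1] at this
  let J : Ideal (RR F k) :=
    { carrier := {r | ∀ s, L (h.ρ (r * s)) = 0}
      add_mem' := fun {a b} ha hb s => by rw [add_mul, h.ρ_add, map_add, ha s, hb s, add_zero]
      zero_mem' := fun s => by rw [zero_mul, h.ρ_A h.A.zero_mem, map_zero]
      smul_mem' := fun c x hx s => by
        have := hx (c * s)
        rw [smul_eq_mul, mul_comm c x, mul_assoc]; exact this }
  have hJ : J ≠ ⊤ := by
    rw [Ideal.ne_top_iff_one]
    intro h2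
    have := h2 1
    rw [mul_one, h.ρ_A h.A.one_mem, hL1] at this
    exact one_ne_zero this
  obtain ⟨m, hm, hJm⟩ := Ideal.exists_le_maximal J hJ
  refine ⟨L, RR F k ⧸ m, Ideal.Quotient.field m, inferInstance, Ideal.Quotient.mkₐ F m, hL, ?_, ?_⟩
  · intro a ha
    have h3 : a - algebraMap F (RR F k) (L a) ∈ J := by
      intro s
      rw [h.ρ_mul (sub_mem ha (h.A.algebraMap_mem _)), hLm _ (sub_mem ha (h.A.algebraMap_mem _)) _ (h.ρ_mem_A s),
        map_sub, Algebra.algebraMap_eq_smul_one, map_smul, hL1, smul_eq_mul, mul_one, sub_self, zero_mul]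
    have h4 := Ideal.Quotient.eq_zero_iff_mem.2 (hJm h3)
    rw [map_sub, sub_eq_zero] at h4
    exact h4
  · intro r hr
    exact Ideal.Quotient.eq_zero_iff_mem.2 (hJm hr)

end fieldK
end PF

namespace PF
open Equiv Finset

section apolar
variable {τ : Type} [Fintype τ] [DecidableEq τ] {C : Type} [CommRing C]

lemma pderiv_comm' (i j : τ) (p : MvPolynomial τ C) :
    MvPolynomial.pderiv i (MvPolynomial.pderiv j p) = MvPolynomial.pderiv j (MvPolynomial.pderiv i p) := by
  ext m
  simp only [MvPolynomial.coeff_pderiv]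
  by_cases h : i = j
  · subst h; rfl
  · simp only [Finsupp.add_apply, Finsupp.single_apply, if_neg h, if_neg (Ne.symm h), add_right_comm]
    simp
    ring

lemma exists_D (τ : Type) [Fintype τ] [DecidableEq τ] (C : Type) [CommRing C] :
    ∃ D : MvPolynomial τ C →ₐ[C] Module.End C (MvPolynomial τ C),
    ∀ i, D (MvPolynomial.X i) = (MvPolynomial.pderiv i).toLinearMap := by
  let s : Set (Module.End C (MvPolynomial τ C)) := Set.range (fun i => (MvPolynomial.pderiv i).toLinearMap)
  have hs : ∀ a ∈ s, ∀ b ∈ s, a * b = b * a := by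
    rintro _ ⟨i, rfl⟩ _ ⟨j, rfl⟩
    refine LinearMap.ext fun p => ?_
    exact pderiv_comm' i j p
  letI : CommRing (Algebra.adjoin C s) := Algebra.adjoinCommRingOfComm C hs
  let D0 : MvPolynomial τ C →ₐ[C] Algebra.adjoin C s :=
    MvPolynomial.aeval (fun i => ⟨(MvPolynomial.pderiv i).toLinearMap, Algebra.subset_adjoin ⟨i, rfl⟩⟩)
  refine ⟨(Algebra.adjoin C s).val.comp D0, fun i => ?_⟩
  simp [D0]

noncomputable def D : MvPolynomial τ C →ₐ[C] Module.End C (MvPolynomial τ C) := (exists_D τ C).choose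

lemma D_X (i : τ) (b : MvPolynomial τ C) : D (MvPolynomial.X i) b = MvPolynomial.pderiv i b := by
  rw [D, (exists_D τ C).choose_spec]; rfl

lemma D_mul (a a' b : MvPolynomial τ C) : D (a * a') b = D a (D a' b) := by
  rw [map_mul]; rfl

lemma D_mul' (a a' b : MvPolynomial τ C) : D (a * a') b = D a' (D a b) := by
  rw [mul_comm, D_mul]

lemma D_C (c : C) (b : MvPolynomial τ C) : D (MvPolynomial.C c) b = MvPolynomial.C c * b := by
  have : (MvPolynomial.C c : MvPolynomial τ C) = algebraMap C _ c := rfl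
  rw [this, AlgHom.commutes, Module.algebraMap_end_apply, Algebra.smul_def]

lemma D_add (a a' b : MvPolynomial τ C) : D (a + a') b = D a b + D a' b := by
  rw [map_add]; rfl

lemma D_map {C' : Type} [CommRing C'] (θ : C →+* C') (a b : MvPolynomial τ C) :
    MvPolynomial.map θ (D a b) = D (MvPolynomial.map θ a) (MvPolynomial.map θ b) := by
  induction a using MvPolynomial.induction_on generalizing b with
  | C c => rw [D_C, map_mul, MvPolynomial.map_C, D_C]
  | add p q hp hq => rw [D_add, map_add, map_add, D_add, hp, hq]
  | mul_X p i hp => rw [D_mul, map_mul, D_mul, hp, MvPolynomial.map_X, D_X, D_X, MvPolynomial.pderiv_map]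

noncomputable def mf (m : τ →₀ ℕ) : ℕ := ∏ i, (m i).factorial

lemma mf_ne (m : τ →₀ ℕ) : mf m ≠ 0 := Finset.prod_ne_zero_iff.2 fun i _ => Nat.factorial_ne_zero _

lemma mf_add (m : τ →₀ ℕ) (i : τ) : mf (m + Finsupp.single i 1) = (m i + 1) * mf m := by
  rw [mf, mf, ← Finset.mul_prod_erase univ _ (mem_univ i), ← Finset.mul_prod_erase univ (fun i => (m i).factorial) (mem_univ i),
    ← mul_assoc]
  congr 1
  · simp [Nat.factorial_succ]
  · refine Finset.prod_congr rfl fun j hj => ?_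
    have : i ≠ j := (Finset.ne_of_mem_erase hj).symm
    simp [Finsupp.single_apply, this]

noncomputable def pr (a b : MvPolynomial τ C) : C := (D a b).coeff 0

lemma pr_monomial_aux (n : ℕ) : ∀ (m : τ →₀ ℕ), m.degree = n → ∀ (c : C) (b : MvPolynomial τ C),
    pr (MvPolynomial.monomial m c) b = mf m * c * b.coeff m := by
  induction n with
  | zero =>
    intro m hm c b
    rw [Finsupp.degree_eq_zero_iff] at hm
    subst hm
    have : (MvPolynomial.monomial 0 c : MvPolynomial τ C) = MvPolynomial.C c := rfl
    rw [pr, this, D_C, MvPolynomial.coeff_C_mul]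
    simp [mf]
  | succ n ih =>
    intro m hm c b
    obtain ⟨i, hi⟩ : ∃ i, m i ≠ 0 := by
      by_contra! h
      have : m = 0 := Finsupp.ext h
      simp [this] at hm
    have h1 : m - Finsupp.single i 1 + Finsupp.single i 1 = m := by
      refine tsub_add_cancel_of_le ?_
      rw [Finsupp.single_le_iff]; omega
    generalize m - Finsupp.single i 1 = m' at h1
    subst h1
    have h2 : m'.degree = n := by simpa using hm
    have h3 : (MvPolynomial.monomial (m' + Finsupp.single i 1) c : MvPolynomial τ C) =
      MvPolynomial.monomial m' c * MvPolynomial.X i := by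
      rw [MvPolynomial.X, MvPolynomial.monomial_mul, mul_one]
    have h4 := ih m' h2 c (MvPolynomial.pderiv i b)
    rw [pr] at h4
    rw [pr, h3, D_mul, D_X, h4, MvPolynomial.coeff_pderiv, mf_add]
    push_cast
    ring

lemma pr_monomial (m : τ →₀ ℕ) (c : C) (b : MvPolynomial τ C) :
    pr (MvPolynomial.monomial m c) b = mf m * c * b.coeff m := pr_monomial_aux _ m rfl c b

lemma pr_add_left (a a' b : MvPolynomial τ C) : pr (a + a') b = pr a b + pr a' b := by
  rw [pr, D_add, MvPolynomial.coeff_add]; rfl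

lemma pr_monomial_right (m : τ →₀ ℕ) (c : C) (a : MvPolynomial τ C) :
    pr a (MvPolynomial.monomial m c) = mf m * a.coeff m * c := by
  induction a using MvPolynomial.induction_on' with
  | monomial u e =>
    rw [pr_monomial, MvPolynomial.coeff_monomial, MvPolynomial.coeff_monomial]
    by_cases h : u = m
    · subst h; simp
    · simp [h, Ne.symm h]
  | add p q hp hq => rw [pr_add_left, hp, hq, MvPolynomial.coeff_add]; ring

lemma pr_map {C' : Type} [CommRing C'] (θ : C →+* C') (a b : MvPolynomial τ C) :
    θ (pr a b) = pr (MvPolynomial.map θ a) (MvPolynomial.map θ b) := by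
  rw [pr, pr, ← D_map, MvPolynomial.coeff_map]

lemma pr_mul (a a' b : MvPolynomial τ C) : pr (a * a') b = pr a (D a' b) := by
  rw [pr, D_mul]; rfl

noncomputable def prB : MvPolynomial τ C →ₗ[C] MvPolynomial τ C →ₗ[C] C :=
  LinearMap.mk₂ C pr pr_add_left
    (fun c a b => by simp [pr])
    (fun a b b' => by simp [pr])
    (fun c a b => by simp [pr])

lemma prB_apply (a b : MvPolynomial τ C) : prB a b = pr a b := rfl

lemma pr_cm {A B : Type} [CommRing A] [CommRing B] {L : A →+ B} {i : B →+* A} (h : ∀ b a, L (i b * a) = b * L a)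
    (a : MvPolynomial τ B) (t : MvPolynomial τ A) : L (pr (MvPolynomial.map i a) t) = pr a (cm L t) := by
  induction a using MvPolynomial.induction_on' with
  | monomial u e =>
    rw [MvPolynomial.map_monomial, pr_monomial, pr_monomial, coeff_cm, ← h]
    congr 1
    simp
  | add p q hp hq => rw [map_add, pr_add_left, map_add, hp, hq, pr_add_left]

open MvPolynomial in
lemma pr_homog {n : ℕ} {p : MvPolynomial τ C} (hp : p.IsHomogeneous n) (c : MvPolynomial τ C) :
    pr p c = pr p (homogeneousComponent n c) := by
  rw [p.as_sum]
  have h1 : ∀ (s : Finset (τ →₀ ℕ)) (b : MvPolynomial τ C), pr (∑ v ∈ s, monomial v (coeff v p)) b =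
      ∑ v ∈ s, mf v * coeff v p * coeff v b := by
    intro s b
    have : pr (∑ v ∈ s, monomial v (coeff v p)) b = prB (∑ v ∈ s, monomial v (coeff v p)) b := rfl
    rw [this, map_sum, LinearMap.sum_apply]
    exact Finset.sum_congr rfl fun v _ => pr_monomial _ _ _
  rw [h1, h1]
  refine Finset.sum_congr rfl fun v hv => ?_
  have h2 : v.degree = n := by
    rw [Finsupp.degree_eq_weight_one]; exact hp (mem_support_iff.1 hv)
  rw [coeff_homogeneousComponent, if_pos h2]

open MvPolynomial in
lemma pr_homog_left {n : ℕ} (p : MvPolynomial τ C) {c : MvPolynomial τ C} (hc : c.IsHomogeneous n) :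
    pr p c = pr (homogeneousComponent n p) c := by
  have h0 : p = ∑ i ∈ range (p.totalDegree + 1), homogeneousComponent i p := (sum_homogeneousComponent p).symm
  have h1 : pr p c = ∑ i ∈ range (p.totalDegree + 1), pr (homogeneousComponent i p) c := by
    conv_lhs => rw [h0]
    rw [← prB_apply, map_sum, LinearMap.sum_apply]
    rfl
  have h2 : ∀ i, pr (homogeneousComponent i p) c = if i = n then pr (homogeneousComponent n p) c else 0 := by
    intro i
    split_ifs with h
    · rw [h]
    · rw [pr_homog (homogeneousComponent_isHomogeneous i p), homogeneousComponent_of_mem hc, if_neg h]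
      simp [pr]
  rw [h1]
  rw [Finset.sum_congr rfl (fun i _ => h2 i), Finset.sum_ite_eq']
  split_ifs with h
  · rfl
  · rw [homogeneousComponent_eq_zero]
    · simp [pr]
    · simpa using h

end apolar
end PF

namespace PF
open Equiv Finset

section tt
variable {k : ℕ} {C : Type} [CommRing C]

lemma TT'_X (g : Matrix (Fin k) (Fin k) C) (p : Fin k × Fin k) : TT' g (MvPolynomial.X p) =
   ∑ c, MvPolynomial.C (g p.2 c) * MvPolynomial.X (p.1, c) := by
  simp [TT']

lemma TT'_C (g : Matrix (Fin k) (Fin k) C) (c : C) : TT' g (MvPolynomial.C c) = MvPolynomial.C c := by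
  simp [TT']

lemma chain (g : Matrix (Fin k) (Fin k) C) (i j : Fin k) (b : MvPolynomial (Fin k × Fin k) C) :
    MvPolynomial.pderiv (i, j) (TT' g b) = ∑ l, MvPolynomial.C (g l j) * TT' g (MvPolynomial.pderiv (i, l) b) := by
  induction b using MvPolynomial.induction_on with
  | C c => simp [TT'_C]
  | add p q hp hq => simp only [map_add, hp, hq, mul_add, Finset.sum_add_distrib]
  | mul_X p q hp =>
    rw [map_mul, Derivation.leibniz, hp]
    simp only [Derivation.leibniz, map_add, mul_add, Finset.sum_add_distrib, smul_eq_mul, map_mul]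
    congr 1
    · rw [TT'_X, map_sum]
      simp only [MvPolynomial.pderiv_C_mul, MvPolynomial.pderiv_X]
      obtain ⟨q1, q2⟩ := q
      by_cases h : i = q1
      · subst h
        rw [Finset.sum_eq_single j, Finset.sum_eq_single q2]
        · simp [mul_comm]
        · intro l _ hl
          rw [Pi.single_eq_of_ne (by simpa using Ne.symm hl)]; simp
        · simp
        · intro l _ hl
          rw [Pi.single_eq_of_ne (by simpa using hl)]; simp
        · simp
      · rw [Finset.sum_eq_zero, Finset.sum_eq_zero]
        · simp
        · intro l _
          rw [Pi.single_eq_of_ne (by simp [Ne.symm h])]; simp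
        · intro l _
          rw [Pi.single_eq_of_ne (by simp [Ne.symm h])]; simp
    · rw [Finset.mul_sum]
      refine Finset.sum_congr rfl fun l _ => ?_
      ring

lemma D_TT {g : Matrix (Fin k) (Fin k) C} (hg : g * g.transpose = 1) (a b : MvPolynomial (Fin k × Fin k) C) :
    D (TT' g a) (TT' g b) = TT' g (D a b) := by
  induction a using MvPolynomial.induction_on generalizing b with
  | C c => rw [TT'_C, D_C, D_C, map_mul, TT'_C]
  | add p q hp hq => rw [map_add, D_add, D_add, map_add, hp, hq]
  | mul_X p q hp =>
    rw [map_mul, D_mul, D_mul, ← hp]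
    congr 1
    rw [TT'_X, map_sum, LinearMap.sum_apply, D_X]
    simp only [D_mul, D_C, D_X, chain]
    obtain ⟨q1, q2⟩ := q
    have h1 : ∀ l, ∑ c, g q2 c * g l c = if q2 = l then 1 else 0 := by
      intro l
      have := congrFun (congrFun hg q2) l
      rw [Matrix.mul_apply, Matrix.one_apply] at this
      exact this
    simp only [Finset.mul_sum]
    rw [Finset.sum_comm]
    have h2 : ∀ l, ∑ c, (MvPolynomial.C (g q2 c) * (MvPolynomial.C (g l c) * TT' g (MvPolynomial.pderiv (q1, l) b)))
        = if q2 = l then TT' g (MvPolynomial.pderiv (q1, l) b) else 0 := by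
      intro l
      rw [Finset.sum_congr rfl (fun c _ => (mul_assoc _ _ _).symm), ← Finset.sum_mul]
      simp only [← map_mul, ← map_sum, h1]
      split_ifs <;> simp
    rw [Finset.sum_congr rfl (fun l _ => h2 l), Finset.sum_ite_eq]
    simp

lemma TT_homog (g : Matrix (Fin k) (Fin k) C) {n : ℕ} {a : MvPolynomial (Fin k × Fin k) C} (ha : a.IsHomogeneous n) :
    (TT' g a).IsHomogeneous n := by
  have := ha.aeval (fun p : Fin k × Fin k => ∑ c, MvPolynomial.C (g p.2 c) * MvPolynomial.X (p.1, c)) (n := 1)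
    (fun p => MvPolynomial.IsHomogeneous.sum _ _ _ fun c _ => (MvPolynomial.isHomogeneous_X _ _).C_mul _)
  rw [one_mul] at this
  exact this

open MvPolynomial in
lemma comp_comm {τ A B : Type} [CommRing A] [CommRing B] (θ : MvPolynomial τ A →+ MvPolynomial τ B)
    (h : ∀ n a, a.IsHomogeneous n → (θ a).IsHomogeneous n) (n : ℕ) (a : MvPolynomial τ A) :
    homogeneousComponent n (θ a) = θ (homogeneousComponent n a) := by
  conv_lhs => rw [← sum_homogeneousComponent a]
  rw [map_sum, map_sum, Finset.sum_congr rfl (fun i _ =>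
    homogeneousComponent_of_mem (h i _ (homogeneousComponent_isHomogeneous i a)))]
  rw [Finset.sum_ite_eq]
  split_ifs with h'
  · rfl
  · rw [homogeneousComponent_eq_zero, map_zero]
    simpa using h'

end tt

section haar
variable {F : Type} [Field F] [CharZero F] {k : ℕ} (h : Haar F k)

lemma Haar.d'_D (a b : SS F k) : h.d' (D a b) = D (h.d' a) (h.d' b) := by
  show TT' h.gR (MvPolynomial.map h.d (D a b)) = _
  rw [D_map, ← D_TT h.gR_orth']
  rfl

lemma Haar.D_mem {a b : SS F k} (ha : a ∈ h.A') (hb : b ∈ h.A') : D a b ∈ h.A' := by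
  rw [h.mem_A'] at *
  rw [h.d'_D, ha, hb, Haar.i', ← D_map]

lemma constCoeff_TT {C : Type} [CommRing C] (g : Matrix (Fin k) (Fin k) C) (a : MvPolynomial (Fin k × Fin k) C) :
    (TT' g a).coeff 0 = a.coeff 0 := by
  induction a using MvPolynomial.induction_on with
  | C c => rw [TT'_C]
  | add p q hp hq => rw [map_add, MvPolynomial.coeff_add, hp, hq, MvPolynomial.coeff_add]
  | mul_X p i hp =>
    simp only [← MvPolynomial.constantCoeff_eq] at *
    rw [map_mul, map_mul, map_mul, TT'_X]
    simp

lemma Haar.coeff_d' (a : SS F k) : (h.d' a).coeff 0 = h.d (a.coeff 0) := by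
  show (TT' h.gR (MvPolynomial.map h.d a)).coeff 0 = _
  rw [constCoeff_TT, MvPolynomial.coeff_map]

lemma Haar.coeff_mem {a : SS F k} (ha : a ∈ h.A') : a.coeff 0 ∈ h.A := by
  rw [h.mem_A, ← h.coeff_d', h.mem_A'.1 ha, Haar.i', MvPolynomial.coeff_map]

lemma Haar.pr_mem {a b : SS F k} (ha : a ∈ h.A') (hb : b ∈ h.A') : pr a b ∈ h.A := h.coeff_mem (h.D_mem ha hb)

lemma Haar.ρ_pr {a : SS F k} (ha : a ∈ h.A') (b : SS F k) : h.ρ (pr a b) = pr a (h.ρ' b) := by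
  rw [Haar.ρ, pr, ← h.coeff_d', h.d'_D, h.mem_A'.1 ha]
  exact pr_cm h.LR_mul a (h.d' b)

lemma Haar.comp_mem {a : SS F k} (ha : a ∈ h.A') (n : ℕ) : MvPolynomial.homogeneousComponent n a ∈ h.A' := by
  rw [h.mem_A'] at *
  have h1 := comp_comm h.d'.toAddMonoidHom (fun n a ha => TT_homog h.gR (ha.map h.d)) n a
  have h2 := comp_comm h.i'.toAddMonoidHom (fun n a ha => ha.map h.i) n a
  have h3 : h.d'.toAddMonoidHom a = h.i'.toAddMonoidHom a := ha
  rw [h3, h2] at h1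
  exact h1.symm

end haar
end PF

namespace PF
open Equiv Finset

section lin
variable {F K M : Type} [Field F] [Field K] [Algebra F K] [AddCommGroup M] [Module K M] [Module F M]
  [IsScalarTower F K M]

lemma lin_repr (N : Submodule F M) (W : Submodule K M) [FiniteDimensional K W] (hNW : ∀ x ∈ N, x ∈ W)
    (B : M →ₗ[K] M →ₗ[K] K) (hB : ∀ a ∈ N, ∀ b ∈ N, ∃ r : F, B a b = algebraMap F K r)
    (hn : ∀ a ∈ N, (∀ b ∈ N, B a b = 0) → a = 0) (π : K →ₗ[F] F) (hπ : π 1 = 1) (φ : M →ₗ[K] K) :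
    ∃ q ∈ N, ∀ c ∈ N, B q c = algebraMap F K (π (φ c)) := by
  classical
  have hπ' : ∀ r : F, π (algebraMap F K r) = r := by
    intro r; rw [Algebra.algebraMap_eq_smul_one, map_smul, hπ]; simp
  obtain ⟨b, hbN, hbs, hli⟩ := exists_linearIndependent K (N : Set M)
  have hliW : LinearIndependent K (fun x : b => (⟨x.1, hNW _ (hbN x.2)⟩ : W)) := by
    refine LinearIndependent.of_comp W.subtype ?_
    exact hli
  have hfin : Finite b := hliW.finite
  have := Fintype.ofFinite b
  have hliN : LinearIndependent F (fun x : b => (⟨x.1, hbN x.2⟩ : N)) := by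
    refine LinearIndependent.of_comp N.subtype ?_
    exact hli.restrict_scalars' F
  have hsm : ∀ (r : F) (a b : M), B (r • a) b = r • B a b := by
    intro r a b
    rw [← algebraMap_smul K r a, map_smul, LinearMap.smul_apply, algebraMap_smul]
  have hsm' : ∀ (r : F) (a : M) (ψ : M →ₗ[K] K), ψ (r • a) = r • ψ a := by
    intro r a b
    rw [← algebraMap_smul K r a, map_smul, algebraMap_smul]
  let T : N →ₗ[F] (b → F) :=
    { toFun := fun c x => π (B c.1 x.1)
      map_add' := fun c d => by ext x; simp
      map_smul' := fun r c => by ext x; simp [hsm] }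
  have hT : Function.Injective T := by
    rw [injective_iff_map_eq_zero]
    intro c hc
    have h1 : ∀ x ∈ b, B c.1 x = 0 := by
      intro x hx
      obtain ⟨r, hr⟩ := hB c.1 c.2 x (hbN hx)
      have h2 : π (B c.1 x) = 0 := congrFun hc ⟨x, hx⟩
      rw [hr, hπ'] at h2
      rw [hr, h2, map_zero]
    have h2 : Submodule.span K b ≤ LinearMap.ker (B c.1) := Submodule.span_le.2 h1
    refine Subtype.ext (hn c.1 c.2 fun x hx => ?_)
    exact h2 (hbs ▸ Submodule.subset_span hx)
  have hfd : FiniteDimensional F N := FiniteDimensional.of_injective T hT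
  have hle : Module.finrank F N ≤ Fintype.card b := by
    have := LinearMap.finrank_le_finrank_of_injective hT
    simpa using this
  have hge : Fintype.card b ≤ Module.finrank F N := hliN.fintype_card_le_finrank
  have hcard : Fintype.card b = Module.finrank F N := le_antisymm hge hle
  have hsurj : Function.Surjective T := by
    refine (LinearMap.injective_iff_surjective_of_finrank_eq_finrank ?_).1 hT
    rw [← hcard]; simp
  have htop := hliN.span_eq_top_of_card_eq_finrank' hcard
  obtain ⟨q, hq⟩ := hsurj (fun x => π (φ x.1))
  refine ⟨q.1, q.2, fun c hc => ?_⟩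
  have hc' : (⟨c, hc⟩ : N) ∈ Submodule.span F (Set.range (fun x : b => (⟨x.1, hbN x.2⟩ : N))) := by
    rw [htop]; trivial
  have key : ∀ c : N, c ∈ Submodule.span F (Set.range (fun x : b => (⟨x.1, hbN x.2⟩ : N))) →
      B q.1 c.1 = algebraMap F K (π (φ c.1)) := by
    intro c hc
    induction hc using Submodule.span_induction with
    | mem x hx =>
      obtain ⟨x, rfl⟩ := hx
      obtain ⟨r, hr⟩ := hB q.1 q.2 x.1 (hbN x.2)
      have h2 : π (B q.1 x.1) = π (φ x.1) := congrFun hq x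
      rw [hr, hπ'] at h2
      simp only
      rw [hr, h2]
    | zero => simp
    | add x y _ _ hx hy => simp [hx, hy]
    | smul r x _ hx =>
      rw [Submodule.coe_smul, hsm', hx, hsm', map_smul, smul_eq_mul, map_mul, Algebra.smul_def]
  exact key ⟨c, hc⟩ hc'

end lin

section fg
variable {F K τ : Type} [Field F] [Field K] [Algebra F K] [Fintype τ] [DecidableEq τ]

open MvPolynomial in
lemma comp_mul {n d : ℕ} (p : MvPolynomial τ K) {t : MvPolynomial τ K} (ht : t.IsHomogeneous d) :
    homogeneousComponent n (p * t) = if d ≤ n then homogeneousComponent (n - d) p * t else 0 := by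
  conv_lhs => rw [← sum_homogeneousComponent p]
  rw [Finset.sum_mul, map_sum, Finset.sum_congr rfl (fun i _ =>
    homogeneousComponent_of_mem ((homogeneousComponent_isHomogeneous i p).mul ht))]
  split_ifs with h
  · have : ∀ i, (n = i + d) ↔ (n - d = i) := by intro i; omega
    simp only [this]
    rw [Finset.sum_ite_eq]
    split_ifs with h'
    · rfl
    · rw [homogeneousComponent_eq_zero, zero_mul]
      rw [Finset.mem_range] at h'
      omega
  · refine Finset.sum_eq_zero fun i _ => if_neg ?_
    omega

variable (Q : Subalgebra F (MvPolynomial τ K))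
  (hD : ∀ a ∈ Q, ∀ b ∈ Q, D a b ∈ Q)
  (hc : ∀ n, ∀ a ∈ Q, MvPolynomial.homogeneousComponent n a ∈ Q)
  (hp : ∀ a ∈ Q, ∀ b ∈ Q, ∃ r : F, pr a b = algebraMap F K r)
  (hn : ∀ a ∈ Q, (∀ b ∈ Q, pr a b = 0) → a = 0)
  (π : K →ₗ[F] F) (hπ : π 1 = 1)

open MvPolynomial in
include hc in
lemma trunc_mem (N : ℕ) (c : MvPolynomial τ K) (hcQ : c ∈ Q) : ∑ i ∈ range (N+1), homogeneousComponent i c ∈ Q :=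
  sum_mem fun i _ => hc i c hcQ

open MvPolynomial in
lemma pr_trunc {N : ℕ} {p : MvPolynomial τ K} (hpN : p.totalDegree ≤ N) (c : MvPolynomial τ K) :
    pr p c = pr p (∑ i ∈ range (N+1), homogeneousComponent i c) := by
  have h0 : p = ∑ i ∈ range (p.totalDegree + 1), homogeneousComponent i p := (sum_homogeneousComponent p).symm
  have h1 : ∀ c, pr p c = ∑ i ∈ range (p.totalDegree + 1), pr (homogeneousComponent i p) c := by
    intro c
    conv_lhs => rw [h0]
    rw [← prB_apply, map_sum, LinearMap.sum_apply]
    rfl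
  rw [h1, h1]
  refine Finset.sum_congr rfl fun i hi => ?_
  rw [pr_homog (homogeneousComponent_isHomogeneous i p), pr_homog (homogeneousComponent_isHomogeneous i p) (∑ i ∈ _, _)]
  congr 1
  rw [map_sum, Finset.sum_congr rfl (fun j _ => homogeneousComponent_of_mem (homogeneousComponent_isHomogeneous j c)),
    Finset.sum_ite_eq, if_pos]
  rw [Finset.mem_range] at *
  omega

open MvPolynomial in
include hc hp hn hπ in
lemma exists_q (p : MvPolynomial τ K) : ∃ q ∈ Q, ∀ c ∈ Q, pr q c = algebraMap F K (π (pr p c)) := by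
  let N := p.totalDegree
  let W := restrictTotalDegree τ K N
  let NN : Submodule F (MvPolynomial τ K) := Subalgebra.toSubmodule Q ⊓ W.restrictScalars F
  have htr : ∀ c ∈ Q, ∑ i ∈ range (N+1), homogeneousComponent i c ∈ NN := by
    intro c hcQ
    refine ⟨trunc_mem Q hc N c hcQ, ?_⟩
    show _ ∈ W
    refine sum_mem fun i hi => ?_
    rw [mem_restrictTotalDegree]
    refine (homogeneousComponent_isHomogeneous i c).totalDegree_le.trans ?_
    rw [Finset.mem_range] at hi; omega
  have htd : ∀ c ∈ NN, c.totalDegree ≤ N := fun c hc => (mem_restrictTotalDegree _ _ _).1 hc.2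
  obtain ⟨q, hq, hq'⟩ := lin_repr NN W (fun x hx => hx.2) prB (fun a ha b hb => hp a ha.1 b hb.1)
    (fun a ha h => hn a ha.1 fun b hb => by
      rw [pr_trunc (htd a ha) b]; exact h _ (htr b hb)) π hπ (prB p)
  refine ⟨q, hq.1, fun c hc => ?_⟩
  rw [pr_trunc (htd q hq), pr_trunc (le_refl N : p.totalDegree ≤ N)]
  exact hq' _ (htr c hc)

include hD hc hp hn hπ in
lemma purity (T : Finset (MvPolynomial τ K)) (hT : ∀ t ∈ T, t ∈ Q) (p : MvPolynomial τ K → MvPolynomial τ K)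
    (a : MvPolynomial τ K) (ha : a ∈ Q) (h : ∑ t ∈ T, p t * t = a) :
    ∃ q : MvPolynomial τ K → MvPolynomial τ K, (∀ t, q t ∈ Q) ∧ ∑ t ∈ T, q t * t = a := by
  have hπ' : ∀ r : F, π (algebraMap F K r) = r := by
    intro r; rw [Algebra.algebraMap_eq_smul_one, map_smul, hπ]; simp
  choose q hq hq' using fun t => exists_q Q hc hp hn π hπ (p t)
  refine ⟨q, hq, ?_⟩
  rw [← sub_eq_zero]
  have hs : ∀ (p : MvPolynomial τ K → MvPolynomial τ K) b, pr (∑ t ∈ T, p t * t) b = ∑ t ∈ T, pr (p t) (D t b) := by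
    intro p b
    rw [← prB_apply, map_sum, LinearMap.sum_apply]
    exact Finset.sum_congr rfl fun t _ => pr_mul _ _ _
  refine hn _ (sub_mem (sum_mem fun t ht => mul_mem (hq t) (hT t ht)) ha) fun b hb => ?_
  have h1 : pr (∑ t ∈ T, q t * t - a) b = pr (∑ t ∈ T, q t * t) b - pr a b := by
    simp only [← prB_apply, map_sub, LinearMap.sub_apply]
  obtain ⟨r, hr⟩ := hp a ha b hb
  rw [h1, hs, Finset.sum_congr rfl (fun t ht => hq' t _ (hD t (hT t ht) b hb)), ← map_sum, ← map_sum, ← hs, h, hr, hπ', sub_self]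

open MvPolynomial in
include hD hc hp hn hπ in
lemma Q_fg : Q.FG := by
  classical
  let S : Set (MvPolynomial τ K) := {t | t ∈ Q ∧ ∃ n, 0 < n ∧ t.IsHomogeneous n}
  obtain ⟨T, hTS, hT⟩ := (Submodule.fg_span_iff_fg_span_finset_subset (R := MvPolynomial τ K) S).1
    (IsNoetherian.noetherian _)
  refine ⟨T, le_antisymm (Algebra.adjoin_le fun t ht => (hTS ht).1) ?_⟩
  have key : ∀ n, ∀ a ∈ Q, a.IsHomogeneous n → a ∈ Algebra.adjoin F (T : Set (MvPolynomial τ K)) := by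
    intro n
    induction n using Nat.strong_induction_on with
    | _ n ih =>
      intro a ha hhom
      rcases Nat.eq_zero_or_pos n with rfl | hpos
      · obtain ⟨r, hr⟩ := hp a ha 1 Q.one_mem
        have h1 : a = C (coeff 0 a) := by
          rw [← totalDegree_eq_zero_iff_eq_C]
          exact Nat.le_zero.1 hhom.totalDegree_le
        have h2 : pr a 1 = coeff 0 a := by
          rw [h1, pr, D_C]; simp
        rw [h1, ← h2, hr]
        have : (C (algebraMap F K r) : MvPolynomial τ K) = algebraMap F _ r := rfl
        rw [this]
        exact Subalgebra.algebraMap_mem _ _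
      · have h1 : a ∈ Submodule.span (MvPolynomial τ K) (T : Set (MvPolynomial τ K)) := by
          rw [← hT]; exact Submodule.subset_span ⟨ha, n, hpos, hhom⟩
        obtain ⟨p, -, hp'⟩ := Submodule.mem_span_finset.1 h1
        obtain ⟨q, hq, hqa⟩ := purity Q hD hc hp hn π hπ T (fun t ht => (hTS ht).1) p a ha hp'
        have h2 : homogeneousComponent n a = a := by
          rw [homogeneousComponent_of_mem hhom, if_pos rfl]
        rw [← h2, ← hqa, map_sum]
        refine sum_mem fun t ht => ?_
        obtain ⟨htQ, d, hd, hdt⟩ := hTS ht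
        rw [comp_mul _ hdt]
        split_ifs with hdn
        · exact mul_mem (ih (n - d) (by omega) _ (hc _ _ (hq t)) (homogeneousComponent_isHomogeneous _ _))
            (Algebra.subset_adjoin ht)
        · exact zero_mem _
  intro a ha
  rw [← sum_homogeneousComponent a]
  exact sum_mem fun i _ => key i _ (hc i a ha) (homogeneousComponent_isHomogeneous _ _)

end fg
end PF

namespace PF
open Equiv Finset

section null
lemma null_alg {F A : Type} [Field F] [IsAlgClosed F] [CommRing A] [Algebra F A] (hfg : Algebra.FiniteType F A)
    (I : Ideal A) (hI : I ≠ ⊤) : ∃ χ : A →ₐ[F] F, ∀ a ∈ I, χ a = 0 := by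
  obtain ⟨m, hm, hIm⟩ := Ideal.exists_le_maximal I hI
  letI : Field (A ⧸ m) := Ideal.Quotient.field m
  have hft : Algebra.FiniteType F (A ⧸ m) := inferInstance
  have : Module.Finite F (A ⧸ m) := finite_of_finite_type_of_isJacobsonRing F (A ⧸ m)
  have hb : Function.Bijective (algebraMap F (A ⧸ m)) := IsAlgClosed.algebraMap_bijective_of_isIntegral
  let e : F ≃ₐ[F] (A ⧸ m) := AlgEquiv.ofBijective (Algebra.ofId F _) hb
  refine ⟨e.symm.toAlgHom.comp (Ideal.Quotient.mkₐ F m), fun a ha => ?_⟩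
  have : Ideal.Quotient.mkₐ F m a = 0 := Ideal.Quotient.eq_zero_iff_mem.2 (hIm ha)
  show e.symm (Ideal.Quotient.mkₐ F m a) = 0
  rw [this, map_zero]
end null

section final
variable {F : Type} [Field F] [CharZero F] {k : ℕ} (h : Haar F k)

noncomputable def xm (k : ℕ) (C : Type) [CommRing C] : Matrix (Fin k) (Fin k) (MvPolynomial (Fin k × Fin k) C) :=
  fun i j => MvPolynomial.X (i, j)

lemma xm_map {C C' : Type} [CommRing C] [CommRing C'] (θ : C →+* C') :
    (xm k C).map (MvPolynomial.map θ) = xm k C' := by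
  ext1 i j
  simp [xm]

noncomputable def YY (F : Type) [Field F] (k : ℕ) (α : Fin k → ℕ) : SS F k :=
  act (xm k (RR F k)) (fun α => MvPolynomial.C (MvPolynomial.X α)) α

lemma Haar.YY_mem (α : Fin k → ℕ) : YY F k α ∈ h.A' := by
  rw [h.mem_A', YY, act_map, act_map]
  have e1 : (xm k (RR F k)).map h.d' = xm k h.RO * (h.gR.map MvPolynomial.C).transpose := by
    refine Matrix.ext fun i j => ?_
    rw [Matrix.mul_apply, Matrix.map_apply]
    show TT' h.gR (MvPolynomial.map h.d (MvPolynomial.X (i, j))) = _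
    rw [MvPolynomial.map_X, TT'_X]
    refine Finset.sum_congr rfl fun c _ => ?_
    rw [mul_comm]; rfl
  have e2 : (fun α => h.d' (MvPolynomial.C (MvPolynomial.X α))) = act (h.gR.map MvPolynomial.C)
      (fun α => h.i' (MvPolynomial.C (MvPolynomial.X α))) := by
    funext α
    rw [h.d'_C, h.d_X, act_map]
    simp [Haar.i', Haar.i]
  have e3 : (xm k (RR F k)).map h.i' = xm k h.RO := xm_map h.i
  have e4 : (h.gR.map (MvPolynomial.C : h.RO →+* h.SO)).transpose * h.gR.map (MvPolynomial.C : h.RO →+* h.SO) = 1 := by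
    have := congrArg (fun A => A.map (MvPolynomial.C : h.RO →+* h.SO)) h.gR_orth
    simp only [Matrix.map_mul, Matrix.transpose_map] at this
    rw [Matrix.map_one _ (map_zero _) (map_one _)] at this
    exact this
  rw [e1, e2, act_act, e3, Matrix.mul_assoc, e4, Matrix.mul_one]

variable {K : Type} [Field K] [Algebra F K] (ev : RR F k →ₐ[F] K)

noncomputable def Haar.Q : Subalgebra F (MvPolynomial (Fin k × Fin k) K) :=
  h.A'.map (MvPolynomial.mapAlgHom ev)

lemma Haar.mem_Q {a : MvPolynomial (Fin k × Fin k) K} : a ∈ h.Q ev ↔ ∃ a' ∈ h.A', MvPolynomial.map ev.toRingHom a' = a :=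
  Iff.rfl

variable {L : RR F k →ₗ[F] F} (h2 : ∀ a ∈ h.A, ev a = algebraMap F K (L a))
  (h3 : ∀ r, (∀ s, L (h.ρ (r * s)) = 0) → ev r = 0)

include h2 h3 in
lemma Haar.Q_fg : (h.Q ev).FG := by
  obtain ⟨π, hπ⟩ : ∃ π : K →ₗ[F] F, π 1 = 1 := by
    obtain ⟨π, hπ⟩ := (Algebra.linearMap F K).exists_leftInverse_of_injective
      (LinearMap.ker_eq_bot.2 (algebraMap F K).injective)
    refine ⟨π, ?_⟩
    have := LinearMap.congr_fun hπ 1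
    simpa using this
  refine PF.Q_fg (h.Q ev) ?_ ?_ ?_ ?_ π hπ
  · rintro _ ⟨a, ha, rfl⟩ _ ⟨b, hb, rfl⟩
    exact ⟨D a b, h.D_mem ha hb, D_map ev.toRingHom a b⟩
  · rintro n _ ⟨a, ha, rfl⟩
    refine ⟨_, h.comp_mem ha n, ?_⟩
    exact (comp_comm (MvPolynomial.map (σ := Fin k × Fin k) ev.toRingHom).toAddMonoidHom (fun n a ha => ha.map _) n a).symm
  · rintro _ ⟨a, ha, rfl⟩ _ ⟨b, hb, rfl⟩
    exact ⟨L (pr a b), by rw [← h2 _ (h.pr_mem ha hb)]; exact (pr_map ev.toRingHom a b).symm⟩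
  · rintro _ ⟨a, ha, rfl⟩ hab
    refine MvPolynomial.ext _ _ fun β => ?_
    show MvPolynomial.coeff β (MvPolynomial.map ev.toRingHom a) = _
    rw [MvPolynomial.coeff_map, MvPolynomial.coeff_zero]
    refine h3 _ fun s => ?_
    have e1 := h.ρ_pr ha (MvPolynomial.monomial β s)
    have e2 : L (pr a (h.ρ' (MvPolynomial.monomial β s))) = 0 := by
      apply (algebraMap F K).injective
      rw [← h2 _ (h.pr_mem ha (h.ρ'_mem _)), map_zero]
      have := hab _ ⟨_, h.ρ'_mem (MvPolynomial.monomial β s), rfl⟩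
      rw [← this]
      exact pr_map ev.toRingHom a _
    rw [← e1, pr_monomial_right, mul_assoc, h.ρ_mul (natCast_mem _ _), ← nsmul_eq_mul, map_nsmul, nsmul_eq_mul] at e2
    exact (mul_eq_zero.1 e2).resolve_left (Nat.cast_ne_zero.2 (mf_ne β))

include h2 h3 in
lemma Haar.exists_y [IsAlgClosed F] {f : MGraph → F} (h1 : ∀ G : MGraph, L (G.pf k MvPolynomial.X) = f G) :
    ∃ y : (Fin k → ℕ) → F, ∀ G : MGraph, f G = MGraph.pf k y G := by
  let KX := MvPolynomial (Fin k × Fin k) K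
  let x : Matrix (Fin k) (Fin k) KX := xm k K
  let J : Ideal KX := Ideal.span (Set.range fun p : Fin k × Fin k => (x.transpose * x - 1) p.1 p.2)
  let I : Ideal (h.Q ev) := J.comap (h.Q ev).val
  have hI : I ≠ ⊤ := by
    have hJ : J ≤ RingHom.ker (MvPolynomial.eval (fun p : Fin k × Fin k => (1 : Matrix (Fin k) (Fin k) K) p.1 p.2)) := by
      refine Ideal.span_le.2 ?_
      rintro _ ⟨⟨i, j⟩, rfl⟩
      have hx : x.map (MvPolynomial.eval (fun p : Fin k × Fin k => (1 : Matrix (Fin k) (Fin k) K) p.1 p.2)) = 1 := by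
        refine Matrix.ext fun i j => ?_
        simp [x, xm]
      have := congrFun (congrFun (show (x.transpose * x - 1).map
        (MvPolynomial.eval (fun p : Fin k × Fin k => (1 : Matrix (Fin k) (Fin k) K) p.1 p.2)) = 0 by
          rw [Matrix.map_sub _ (fun a b => map_sub _ a b), Matrix.map_mul, Matrix.transpose_map, hx,
            Matrix.map_one _ (map_zero _) (map_one _)]; simp) i) j
      exact this
    rw [Ideal.ne_top_iff_one]
    intro h1I
    have : (1 : KX) ∈ J := h1I
    have := hJ this
    rw [RingHom.mem_ker, map_one] at this
    exact one_ne_zero this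
  obtain ⟨χ, hχ⟩ := null_alg ((Subalgebra.fg_iff_finiteType _).1 (h.Q_fg ev h2 h3)) I hI
  let yq : (Fin k → ℕ) → h.Q ev := fun α => ⟨MvPolynomial.map ev.toRingHom (YY F k α), _, h.YY_mem α, rfl⟩
  refine ⟨fun α => χ (yq α), fun G => ?_⟩
  have e1 : χ (G.pf k yq) = G.pf k (fun α => χ (yq α)) := pf_map χ.toRingHom yq G
  have e2 : G.pf k yq - algebraMap F _ (f G) ∈ I := by
    show (h.Q ev).val (G.pf k yq - algebraMap F _ (f G)) ∈ J
    rw [← Ideal.Quotient.eq_zero_iff_mem]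
    rw [map_sub, map_sub, AlgHom.commutes, sub_eq_zero]
    have e3 : (h.Q ev).val (G.pf k yq) = G.pf k (fun α => MvPolynomial.map ev.toRingHom (YY F k α)) :=
      pf_map (h.Q ev).val.toRingHom yq G
    rw [e3, pf_map]
    have e4 : (fun α => (Ideal.Quotient.mk J) (MvPolynomial.map ev.toRingHom (YY F k α))) =
        act (x.map (Ideal.Quotient.mk J)) (fun α => Ideal.Quotient.mk J (MvPolynomial.C (ev (MvPolynomial.X α)))) := by
      funext α
      rw [YY, act_map, act_map, xm_map]
      simp
      rfl
    have e5 : (x.map (Ideal.Quotient.mk J)).transpose * (x.map (Ideal.Quotient.mk J)) = 1 := by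
      have : (x.transpose * x - 1).map (Ideal.Quotient.mk J) = 0 := by
        refine Matrix.ext fun i j => ?_
        exact Ideal.Quotient.eq_zero_iff_mem.2 (Ideal.subset_span ⟨(i, j), rfl⟩)
      rw [Matrix.map_sub _ (fun a b => map_sub _ a b), Matrix.map_mul, Matrix.transpose_map,
            Matrix.map_one _ (map_zero _) (map_one _), sub_eq_zero] at this
      exact this
    rw [e4, pf_act e5]
    have e6 := pf_map ((Ideal.Quotient.mk J).comp (MvPolynomial.C.comp ev.toRingHom)) (MvPolynomial.X : _ → RR F k) G
    have e7 : ((Ideal.Quotient.mk J).comp (MvPolynomial.C.comp ev.toRingHom)) (G.pf k (MvPolynomial.X : _ → RR F k)) =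
       Ideal.Quotient.mk J (MvPolynomial.C (ev (G.pf k MvPolynomial.X))) := rfl
    rw [e7, h2 _ (h.pf_mem G), h1] at e6
    exact e6.symm
  have e8 := hχ _ e2
  rw [map_sub, AlgHom.commutes, sub_eq_zero, e1] at e8
  exact e8.symm

end final
end PF

/-- Theorem 1 of the paper: over an algebraically closed field of
characteristic 0, a graph parameter `f` (a function on multigraphs invariant under
isomorphism) is the partition function of a `k`-color vertex model if and only if it
is multiplicative and satisfies the signed edge-addition condition for sets of `k+1`
vertices. -/
theorem pf_characterization {F : Type} [Field F] [IsAlgClosed F] [CharZero F]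
    (k : ℕ) (f : MGraph → F)
    (hiso : ∀ G H : MGraph, Nonempty (G.Iso H) → f G = f H) :
    (∃ y : (Fin k → ℕ) → F, ∀ G : MGraph, f G = MGraph.pf k y G) ↔
      ((f MGraph.empty = 1 ∧ ∀ G H : MGraph, f (G.disjUnion H) = f G * f H) ∧
        ∀ (G : MGraph) (U : Finset G.V), U.card = k + 1 → ∀ s : {v // v ∈ U} → G.V,
          ∑ π : Equiv.Perm {v // v ∈ U},
            ((Equiv.Perm.sign π : ℤ) : F) * f (G.addEdges U (s ∘ π)) = 0) := by
  constructor
  · rintro ⟨y, hy⟩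
    refine ⟨⟨?_, ?_⟩, ?_⟩
    · rw [hy, PF.pf_empty]
    · intro G H
      rw [hy, hy, hy, PF.pf_mul]
    · intro G U hU s
      have := PF.pf_alt y G U hU s
      simp only [hy]
      exact this
  · rintro ⟨⟨h1, hmul⟩, ha⟩
    obtain ⟨h⟩ := PF.nonempty_haar F k
    obtain ⟨L, K, iK, iA, ev, e1, e2, e3⟩ := h.exists_K hiso ha h1 hmul
    exact h.exists_y ev e2 e3 e1
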